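/- If φ is a sentence in the first-order language of set theory with the property that ZFC + φ is a consistent theory, then ZFC + φ does not prove the scheme "Ord is essentially subtle". -/

import Mathlib

namespace Paper

/-- First-order formulas in the language of set theory (one binary relation, membership),
using de Bruijn variables; `all` binds the last variable. -/
inductive SetFormula : ℕ → Type
  | mem {n : ℕ} (i j : Fin n) : SetFormula n
  | eq {n : ℕ} (i j : Fin n) : SetFormula n
  | fal {n : ℕ} : SetFormula n
  | imp {n : ℕ} (φ ψ : SetFormula n) : SetFormula n
  | all {n : ℕ} (φ : SetFormula (n + 1)) : SetFormula n

namespace SetFormula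

/-- Negation. -/
def not {n : ℕ} (φ : SetFormula n) : SetFormula n := φ.imp .fal

/-- Conjunction. -/
def and {n : ℕ} (φ ψ : SetFormula n) : SetFormula n := (φ.imp ψ.not).not

/-- Existential quantification (over the last variable). -/
def ex {n : ℕ} (φ : SetFormula (n + 1)) : SetFormula n := (SetFormula.all φ.not).not

end SetFormula

/-- Satisfaction of a set-theoretic formula in a structure `(M, E)`, where `E` interprets
the membership relation. -/
def Realize {M : Type*} (E : M → M → Prop) : ∀ {n : ℕ}, SetFormula n → (Fin n → M) → Prop
  | _, .mem i j, v => E (v i) (v j)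
  | _, .eq i j, v => v i = v j
  | _, .fal, _ => False
  | _, .imp φ ψ, v => Realize E φ v → Realize E ψ v
  | _, .all φ, v => ∀ a, Realize E φ (Fin.snoc v a)

/-- Satisfaction of a formula relativized to the subclass `S` of `M`; all quantifiers
range over `S`, and the assignment is required to take values in `S`. -/
def RealizeIn {M : Type*} (E : M → M → Prop) (S : M → Prop) {n : ℕ}
    (φ : SetFormula n) (v : Fin n → M) : Prop :=
  ∃ h : ∀ i, S (v i),
    Realize (fun a b : {x : M // S x} => E a.1 b.1) φ fun i => ⟨v i, h i⟩

/-- `Δ₀`-formulas: formulas all of whose quantifiers are bounded. -/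
inductive IsDelta0 : ∀ {n : ℕ}, SetFormula n → Prop
  | mem {n : ℕ} (i j : Fin n) : IsDelta0 (.mem i j)
  | eq {n : ℕ} (i j : Fin n) : IsDelta0 (.eq i j)
  | fal {n : ℕ} : IsDelta0 (n := n) .fal
  | imp {n : ℕ} {φ ψ : SetFormula n} : IsDelta0 φ → IsDelta0 ψ → IsDelta0 (φ.imp ψ)
  | ball {n : ℕ} (j : Fin n) {φ : SetFormula (n + 1)} :
      IsDelta0 φ → IsDelta0 (.all ((SetFormula.mem (Fin.last n) j.castSucc).imp φ))
  | bex {n : ℕ} (j : Fin n) {φ : SetFormula (n + 1)} :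
      IsDelta0 φ → IsDelta0 (SetFormula.ex ((SetFormula.mem (Fin.last n) j.castSucc).and φ))

mutual
  /-- `Σₙ`-formulas of the Lévy hierarchy. -/
  inductive IsSigma : ℕ → ∀ {n : ℕ}, SetFormula n → Prop
    | ofDelta0 {k n : ℕ} {φ : SetFormula n} : IsDelta0 φ → IsSigma k φ
    | ofPi {k n : ℕ} {φ : SetFormula n} : IsPi k φ → IsSigma (k + 1) φ
    | ex {k n : ℕ} {φ : SetFormula (n + 1)} : IsSigma (k + 1) φ → IsSigma (k + 1) φ.ex
  /-- `Πₙ`-formulas of the Lévy hierarchy. -/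
  inductive IsPi : ℕ → ∀ {n : ℕ}, SetFormula n → Prop
    | ofDelta0 {k n : ℕ} {φ : SetFormula n} : IsDelta0 φ → IsPi k φ
    | ofSigma {k n : ℕ} {φ : SetFormula n} : IsSigma k φ → IsPi (k + 1) φ
    | all {k n : ℕ} {φ : SetFormula (n + 1)} : IsPi (k + 1) φ → IsPi (k + 1) φ.all
end

end Paper
namespace Paper

section Generic

variable {M : Type*} (E : M → M → Prop)

/-- `x` is a transitive set (relative to the membership relation `E`). -/
def TransE (x : M) : Prop := ∀ y, E y x → ∀ z, E z y → E z x

/-- `x` is an ordinal: a transitive set all of whose elements are transitive. -/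
def OrdE (x : M) : Prop := TransE E x ∧ ∀ y, E y x → TransE E y

/-- `a ⊆ b`. -/
def SubE (a b : M) : Prop := ∀ z, E z a → E z b

/-- `a ≤ b` for ordinals. -/
def LeE (a b : M) : Prop := E a b ∨ a = b

/-- `x` is the empty set. -/
def EmptyE (x : M) : Prop := ∀ z, ¬ E z x

/-- `s = y ∪ {y}`. -/
def SuccSpecE (s y : M) : Prop := ∀ z, E z s ↔ (E z y ∨ z = y)

/-- `l` is a (nonzero) limit ordinal. -/
def LimitE (l : M) : Prop := OrdE E l ∧ (∃ w, E w l) ∧ ∀ α, E α l → ∃ β, E β l ∧ E α β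

/-- `w` is the first infinite ordinal `ω`. -/
def OmegaSpecE (w : M) : Prop := LimitE E w ∧ ∀ x, E x w → ¬ LimitE E x

/-- `x` is an infinite ordinal, i.e. an ordinal with `ω ≤ x`. -/
def InfiniteOrdE (x : M) : Prop := OrdE E x ∧ ∃ w, OmegaSpecE E w ∧ LeE E w x

/-- `p = {a, b}`. -/
def UPairE (p a b : M) : Prop := ∀ z, E z p ↔ (z = a ∨ z = b)

/-- `p` is the Kuratowski ordered pair `⟨a, b⟩`. -/
def OPairE (p a b : M) : Prop :=
  ∃ s t, UPairE E s a a ∧ UPairE E t a b ∧ UPairE E p s t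

/-- The ordered pair `⟨x, y⟩` is an element of `f`. -/
def PairMemE (f x y : M) : Prop := ∃ p, E p f ∧ OPairE E p x y

/-- `f` is (the graph of) a function from `a` to `b`. -/
def IsFuncE (f a b : M) : Prop :=
  (∀ p, E p f → ∃ x y, E x a ∧ E y b ∧ OPairE E p x y) ∧
    ∀ x, E x a → (∃ y, PairMemE E f x y) ∧
      ∀ y y', PairMemE E f x y → PairMemE E f x y' → y = y'

/-- `f` is a surjection from `a` onto `b`. -/
def SurjE (f a b : M) : Prop :=
  IsFuncE E f a b ∧ ∀ y, E y b → ∃ x, E x a ∧ PairMemE E f x y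

/-- `f` is an injection from `a` into `b`. -/
def InjE (f a b : M) : Prop :=
  IsFuncE E f a b ∧ ∀ x x' y, E x a → E x' a →
    PairMemE E f x y → PairMemE E f x' y → x = x'

/-- `f` is a bijection between `a` and `b`. -/
def BijE (f a b : M) : Prop := SurjE E f a b ∧ InjE E f a b

/-- `κ` is a cardinal: an ordinal not in bijection with any of its elements. -/
def CardE (κ : M) : Prop := OrdE E κ ∧ ∀ α, E α κ → ¬ ∃ f, BijE E f α κ

/-- `κ` is an infinite cardinal. -/
def InfCardE (κ : M) : Prop := CardE E κ ∧ InfiniteOrdE E κ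

/-- `b = a ∩ c`. -/
def InterSpecE (b a c : M) : Prop := ∀ z, E z b ↔ (E z a ∧ E z c)

/-- `c` is unbounded in the ordinal `κ`. -/
def UnboundedInE (c κ : M) : Prop := ∀ α, E α κ → ∃ β, E β c ∧ E α β

/-- `c` is closed in the ordinal `κ`: it contains each of its limit points below `κ`. -/
def ClosedInE (c κ : M) : Prop :=
  ∀ l, E l κ → (∃ w, E w l) → (∀ α, E α l → ∃ β, E β c ∧ E α β ∧ E β l) → E l c

/-- `c` is a closed unbounded subset of the ordinal `κ`. -/
def ClubInE (c κ : M) : Prop := SubE E c κ ∧ UnboundedInE E c κ ∧ ClosedInE E c κ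

/-- `f` is (the graph of) a sequence `⟨A_α | α < κ⟩` with `A_α ⊆ α` for all `α < κ`. -/
def SeqSpecE (f κ : M) : Prop :=
  ∀ α, E α κ → (∃ A, PairMemE E f α A ∧ SubE E A α) ∧
    ∀ A A', PairMemE E f α A → PairMemE E f α A' → A = A'

/-- `κ` is a subtle cardinal. -/
def SubtleE (κ : M) : Prop :=
  InfCardE E κ ∧ ∀ f, SeqSpecE E f κ → ∀ c, ClubInE E c κ →
    ∃ α β, E α c ∧ E β c ∧ E α β ∧
      ∃ A B, PairMemE E f α A ∧ PairMemE E f β B ∧ InterSpecE E A B α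

/-- `κ` is a regular ordinal: every function from an element of `κ` to `κ` has
bounded range. -/
def RegularE (κ : M) : Prop :=
  OrdE E κ ∧ ∀ γ f, E γ κ → IsFuncE E f γ κ →
    ∃ β, E β κ ∧ ∀ x y, PairMemE E f x y → E y β

/-- `p = 𝒫(a)`. -/
def PowSpecE (p a : M) : Prop := ∀ z, E z p ↔ SubE E z a

/-- `κ` is a strong limit cardinal: for every `α < κ`, `2^|α| < κ`. -/
def StrongLimitE (κ : M) : Prop :=
  ∀ α, E α κ → ∀ p, PowSpecE E p α → ∃ β f, E β κ ∧ InjE E f p β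

/-- `κ` is a strongly inaccessible cardinal: an uncountable regular strong limit
cardinal. -/
def InaccE (κ : M) : Prop :=
  CardE E κ ∧ (∃ w, OmegaSpecE E w ∧ E w κ) ∧ RegularE E κ ∧ StrongLimitE E κ

/-- `z` belongs to the transitive closure of `x`. -/
def TCMemE (z x : M) : Prop := ∀ t, TransE E t → SubE E x t → E z t

/-- `x ∈ H(θ)`: the transitive closure of `x` has cardinality less than `θ`. -/
def HMemE (x θ : M) : Prop :=
  ∃ t, TransE E t ∧ SubE E x t ∧ ∃ β f, E β θ ∧ SurjE E f β t

/-- `f` is (the graph of) the cumulative-hierarchy sequence `⟨V_β | β < α⟩`,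
determined by the recursion `V_β = {z | ∃ γ < β, z ⊆ V_γ}`. -/
def VHierE (f α : M) : Prop :=
  OrdE E α ∧ ∀ β, E β α →
    (∃ w, PairMemE E f β w ∧
      ∀ z, E z w ↔ ∃ γ, E γ β ∧ ∃ u, PairMemE E f γ u ∧ SubE E z u) ∧
    ∀ w w', PairMemE E f β w → PairMemE E f β w' → w = w'

/-- `x ∈ V_α`. -/
def VMemE (x α : M) : Prop :=
  OrdE E α ∧ ∃ f, VHierE E f α ∧ ∃ β u, E β α ∧ PairMemE E f β u ∧ SubE E x u

/-- The class `S` is a `Σₙ`-elementary subclass of the class `T`. -/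
def SigmaElemPairE (n : ℕ) (S T : M → Prop) : Prop :=
  (∀ x, S x → T x) ∧
    ∀ ⦃k : ℕ⦄ (φ : SetFormula k), IsSigma n φ → ∀ v : Fin k → M, (∀ i, S (v i)) →
      (RealizeIn E S φ v ↔ RealizeIn E T φ v)

/-- The class `S` is a (fully) elementary subclass of the class `T`. -/
def ElemPairE (S T : M → Prop) : Prop :=
  (∀ x, S x → T x) ∧
    ∀ ⦃k : ℕ⦄ (φ : SetFormula k) (v : Fin k → M), (∀ i, S (v i)) →
      (RealizeIn E S φ v ↔ RealizeIn E T φ v)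

/-- `j` is an elementary map from the class `S` into the class `T`. -/
def ElemMapE (S T : M → Prop) (j : M → M) : Prop :=
  (∀ x, S x → T (j x)) ∧
    ∀ ⦃k : ℕ⦄ (φ : SetFormula k) (v : Fin k → M), (∀ i, S (v i)) →
      (RealizeIn E S φ v ↔ RealizeIn E T φ fun i => j (v i))

/-- `α ∈ C⁽ⁿ⁾`: the ordinal `α` is `Σₙ`-correct, i.e. `V_α` is a `Σₙ`-elementary
submodel of the universe. -/
def CnE (n : ℕ) (α : M) : Prop :=
  OrdE E α ∧ SigmaElemPairE E n (fun x => VMemE E x α) fun _ => True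

/-- `κ` is a weakly shrewd cardinal. -/
def WeaklyShrewdE (κ : M) : Prop :=
  CardE E κ ∧ ∀ (φ : SetFormula 2) (θ z : M), CardE E θ → E κ θ → SubE E z κ →
    RealizeIn E (fun x => HMemE E x θ) φ ![z, κ] →
    ∃ κ' θ' z', CardE E κ' ∧ CardE E θ' ∧ E κ' θ' ∧ E κ' κ ∧
      InterSpecE E z' z κ' ∧ RealizeIn E (fun x => HMemE E x θ') φ ![z', κ']

/-- `κ` is a `C⁽ⁿ⁾`-weakly shrewd cardinal. -/
def CnWeaklyShrewdE (n : ℕ) (κ : M) : Prop :=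
  CardE E κ ∧ ∀ (φ : SetFormula 2) (θ z : M), CardE E θ → CnE E n θ → E κ θ →
    SubE E z κ → RealizeIn E (fun x => HMemE E x θ) φ ![z, κ] →
    ∃ κ' θ' z', CardE E κ' ∧ CardE E θ' ∧ CnE E n θ' ∧ E κ' θ' ∧ E κ' κ ∧
      InterSpecE E z' z κ' ∧ RealizeIn E (fun x => HMemE E x θ') φ ![z', κ']

/-- Axiom of extensionality for `(M, E)`. -/
def AxExtE : Prop := ∀ x y : M, (∀ z, E z x ↔ E z y) → x = y

/-- Axiom of pairing for `(M, E)`. -/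
def AxPairE : Prop := ∀ a b : M, ∃ p, UPairE E p a b

/-- Axiom of union for `(M, E)`. -/
def AxUnionE : Prop := ∀ a : M, ∃ u, ∀ z, E z u ↔ ∃ y, E y a ∧ E z y

/-- Axiom of power set for `(M, E)`. -/
def AxPowE : Prop := ∀ a : M, ∃ p, PowSpecE E p a

/-- Axiom of infinity for `(M, E)`. -/
def AxInfE : Prop :=
  ∃ I : M, (∃ e, E e I ∧ EmptyE E e) ∧ ∀ y, E y I → ∃ s, E s I ∧ SuccSpecE E s y

/-- Axiom of foundation for `(M, E)`. -/
def AxFoundE : Prop :=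
  ∀ a : M, (∃ z, E z a) → ∃ m, E m a ∧ ∀ z, E z a → ¬ E z m

/-- Separation scheme for `(M, E)`. -/
def AxSepE : Prop :=
  ∀ (k : ℕ) (φ : SetFormula (k + 1)) (p : Fin k → M) (a : M),
    ∃ s : M, ∀ z, E z s ↔ (E z a ∧ Realize E φ (Fin.cons z p))

/-- Replacement scheme for `(M, E)`. -/
def AxReplE : Prop :=
  ∀ (k : ℕ) (φ : SetFormula (k + 2)) (p : Fin k → M) (a : M),
    (∀ x, E x a → ∀ y y', Realize E φ (Fin.cons x (Fin.cons y p)) →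
      Realize E φ (Fin.cons x (Fin.cons y' p)) → y = y') →
    ∃ b : M, ∀ y, E y b ↔ ∃ x, E x a ∧ Realize E φ (Fin.cons x (Fin.cons y p))

/-- Axiom of choice for `(M, E)`. -/
def AxChoiceE : Prop :=
  ∀ a : M, (∀ x, E x a → ∃ z, E z x) →
    (∀ x y, E x a → E y a → x ≠ y → ¬ ∃ z, E z x ∧ E z y) →
    ∃ c, ∀ x, E x a → ∃ z, E z c ∧ E z x ∧ ∀ z', E z' c → E z' x → z' = z

/-- `(M, E)` is a model of `ZF⁻` (Zermelo–Fraenkel set theory without the power set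
axiom). -/
def IsZFMinusE : Prop :=
  AxExtE E ∧ AxPairE E ∧ AxUnionE E ∧ AxInfE E ∧ AxFoundE E ∧ AxSepE E ∧ AxReplE E

/-- `(M, E)` is a model of `ZFC`. -/
def IsZFCE : Prop :=
  Nonempty M ∧ IsZFMinusE E ∧ AxPowE E ∧ AxChoiceE E

/-- The set `m` is, with the induced membership relation, a transitive model
of `ZF⁻`. -/
def ZFMinusModelE (m : M) : Prop :=
  IsZFMinusE fun a b : {x : M // E x m} => E a.1 b.1

/-- `x` has cardinality `κ`. -/
def CardEqE (x κ : M) : Prop := ∃ f, BijE E f κ x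

/-- `m` is closed under sequences of length less than `κ`: `^{<κ}m ⊆ m`. -/
def SmallSeqClosedE (m κ : M) : Prop := ∀ γ f, E γ κ → IsFuncE E f γ m → E f m

/-- `κ` is a `C⁽ⁿ⁾`-strongly unfoldable cardinal. -/
def CnStronglyUnfoldableE (n : ℕ) (κ : M) : Prop :=
  InaccE E κ ∧ ∀ lam, CnE E n lam → E κ lam →
    ∀ m, TransE E m → ZFMinusModelE E m → CardEqE E m κ → E κ m →
      SmallSeqClosedE E m κ →
      ∃ N j κ', TransE E N ∧ (∀ x, VMemE E x lam → E x N) ∧ IsFuncE E j m N ∧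
        (∀ ⦃k : ℕ⦄ (φ : SetFormula k) (v w : Fin k → M), (∀ i, E (v i) m) →
          (∀ i, PairMemE E j (v i) (w i)) →
          (RealizeIn E (fun x => E x m) φ v ↔ RealizeIn E (fun x => E x N) φ w)) ∧
        (∀ α, E α κ → PairMemE E j α α) ∧ PairMemE E j κ κ' ∧ E lam κ' ∧
        SigmaElemPairE E n (fun x => VMemE E x lam) fun x => E x N ∧ VMemE E x κ'

/-- `x` is ordinal definable. -/
def IsODE (x : M) : Prop :=
  ∃ (k : ℕ) (φ : SetFormula (k + 1)) (p : Fin k → M), (∀ i, OrdE E (p i)) ∧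
    Realize E φ (Fin.cons x p) ∧ ∀ y, Realize E φ (Fin.cons y p) → y = x

/-- `x` is hereditarily ordinal definable, i.e. `x ∈ HOD`. -/
def IsHODE (x : M) : Prop := IsODE E x ∧ ∀ z, TCMemE E z x → IsODE E z

/-- The instance of the principle "`Ord` is essentially faint" for the class
sequence `⟨{A | Efam α A} | α ∈ Ord⟩`. -/
def FaintForE (Efam : M → M → Prop) : Prop :=
  (∀ α, OrdE E α → (∃ A, Efam α A) ∧ ∀ A, Efam α A → SubE E A α) →
    ∀ ξ, OrdE E ξ → ∃ α β A B, OrdE E α ∧ OrdE E β ∧ E ξ α ∧ E α β ∧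
      Efam β A ∧ InterSpecE E B A α ∧ Efam α B

/-- `C` is a closed unbounded class of ordinals. -/
def ClubClassE (C : M → Prop) : Prop :=
  (∀ x, C x → OrdE E x) ∧ (∀ α, OrdE E α → ∃ β, C β ∧ E α β) ∧
    ∀ l, OrdE E l → (∃ w, E w l) → (∀ α, E α l → ∃ β, C β ∧ E α β ∧ E β l) → C l

/-- The instance of the principle "`Ord` is essentially subtle" for the class
sequence `⟨{A | Efam α A} | α ∈ Ord⟩` and the class `C`. -/
def SubtleForE (Efam : M → M → Prop) (C : M → Prop) : Prop :=
  (∀ α, OrdE E α → (∃ A, Efam α A) ∧ ∀ A, Efam α A → SubE E A α) →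
    ClubClassE E C →
    ∃ α β A B, C α ∧ C β ∧ E α β ∧ Efam β A ∧ InterSpecE E B A α ∧ Efam α B

/-- The scheme "`Ord` is essentially faint" holds in `(M, E)`: every instance for a
definable (with parameters) class sequence holds. -/
def OrdFaintDefE : Prop :=
  ∀ (k : ℕ) (φ : SetFormula (k + 2)) (p : Fin k → M),
    FaintForE E fun α A => Realize E φ (Fin.cons α (Fin.cons A p))

/-- The scheme "`Ord` is essentially subtle" holds in `(M, E)`: every instance for
definable (with parameters) class sequences and club classes holds. -/
def OrdSubtleDefE : Prop :=
  ∀ (k k' : ℕ) (φ : SetFormula (k + 2)) (p : Fin k → M)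
    (ψ : SetFormula (k' + 1)) (q : Fin k' → M),
    SubtleForE E (fun α A => Realize E φ (Fin.cons α (Fin.cons A p)))
      fun x => Realize E ψ (Fin.cons x q)

/-- There is a proper class of subtle cardinals in `(M, E)`. -/
def ProperClassSubtleE : Prop := ∀ α, OrdE E α → ∃ κ, SubtleE E κ ∧ E α κ

/-- There are no strongly inaccessible cardinals in `(M, E)`. -/
def NoInaccE : Prop := ∀ κ, ¬ InaccE E κ

end Generic

end Paper

namespace Paper


/-! ## Definability infrastructure -/

/-- Renaming of variables in a formula. -/
def ren : ∀ {n : ℕ}, SetFormula n → ∀ {m : ℕ}, (Fin n → Fin m) → SetFormula m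
  | _, .mem i j, _, f => .mem (f i) (f j)
  | _, .eq i j, _, f => .eq (f i) (f j)
  | _, .fal, _, _ => .fal
  | _, .imp φ ψ, _, f => .imp (ren φ f) (ren ψ f)
  | n, .all φ, m, f =>
      .all (ren φ (Fin.snoc (α := fun _ => Fin (m + 1)) (fun i : Fin n => (f i).castSucc)
        (Fin.last m)))

theorem realize_ren {M : Type} {E : M → M → Prop} : ∀ {n : ℕ} (φ : SetFormula n) {m : ℕ}
    (f : Fin n → Fin m) (v : Fin m → M), Realize E (ren φ f) v ↔ Realize E φ (fun i => v (f i))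
  | _, .mem i j, _, f, v => Iff.rfl
  | _, .eq i j, _, f, v => Iff.rfl
  | _, .fal, _, _, _ => Iff.rfl
  | _, .imp φ ψ, _, f, v => by
      simp only [ren, Realize, realize_ren φ, realize_ren ψ]
  | n, .all φ, m, f, v => by
      simp only [ren, Realize, realize_ren φ]
      refine forall_congr' fun a => ?_
      have : (fun i => (Fin.snoc v a : Fin (m + 1) → M)
          ((Fin.snoc (fun i : Fin n => (f i).castSucc) (Fin.last m) :
            Fin (n + 1) → Fin (m + 1)) i))
          = (Fin.snoc (fun i => v (f i)) a : Fin (n + 1) → M) := by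
        funext i
        refine Fin.lastCases ?_ (fun j => ?_) i <;> simp
      exact iff_of_eq (congrArg _ this)

/-- A term: a variable or a parameter. -/
class DefT {M : Type} (t : (ℕ → M) → M) : Prop where
  out : ∃ c : ℕ ⊕ M, ∀ s, t s = Sum.elim s id c

instance defT_var {M : Type} (i : ℕ) : DefT (fun s : ℕ → M => s i) := ⟨⟨.inl i, fun _ => rfl⟩⟩
instance defT_const {M : Type} (c : M) : DefT (fun _ : ℕ → M => c) := ⟨⟨.inr c, fun _ => rfl⟩⟩

/-- Definability with parameters of a predicate on assignments. -/
class DefP {M : Type} (E : M → M → Prop) (P : (ℕ → M) → Prop) : Prop where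
  out : ∃ (n : ℕ) (φ : SetFormula n) (τ : Fin n → ℕ ⊕ M),
    ∀ s, P s ↔ Realize E φ (fun i => Sum.elim s id (τ i))

/-- Definability of a binary relation. -/
class Def2 {M : Type} (E : M → M → Prop) (R : M → M → Prop) : Prop where
  out : DefP E (fun s => R (s 0) (s 1))

section DefClosure
variable {M : Type} {E : M → M → Prop}

instance defP_mem {t u : (ℕ → M) → M} [ht : DefT t] [hu : DefT u] :
    DefP E (fun s => E (t s) (u s)) := by
  obtain ⟨c, hc⟩ := ht.out
  obtain ⟨d, hd⟩ := hu.out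
  exact ⟨2, .mem 0 1, ![c, d], fun s => by simp [Realize, hc, hd]⟩

instance defP_eq {t u : (ℕ → M) → M} [ht : DefT t] [hu : DefT u] :
    DefP E (fun s => t s = u s) := by
  obtain ⟨c, hc⟩ := ht.out
  obtain ⟨d, hd⟩ := hu.out
  exact ⟨2, .eq 0 1, ![c, d], fun s => by simp [Realize, hc, hd]⟩

instance defP_false : DefP E (fun _ => False) := ⟨0, .fal, ![], fun _ => Iff.rfl⟩

instance defP_imp {P Q : (ℕ → M) → Prop} [hP : DefP E P] [hQ : DefP E Q] :
    DefP E (fun s => P s → Q s) := by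
  classical
  obtain ⟨n, φ, τ, h⟩ := hP.out
  obtain ⟨m, ψ, σ, k⟩ := hQ.out
  refine ⟨n + m, .imp (ren φ (Fin.castAdd m)) (ren ψ (Fin.natAdd n)), Fin.append τ σ, fun s => ?_⟩
  simp only [Realize, realize_ren, Fin.append_left, Fin.append_right, ← h, ← k]

instance defP_all {P : (ℕ → M) → M → Prop}
    [hP : DefP E (fun s => P (fun i => s (i + 1)) (s 0))] :
    DefP E (fun s => ∀ a, P s a) := by
  classical
  obtain ⟨n, φ, τ, h⟩ := hP.out
  refine ⟨n, .all (ren φ (fun i => if τ i = .inl 0 then Fin.last n else i.castSucc)),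
    fun i => Sum.elim (fun k => .inl (k - 1)) .inr (τ i), fun s => ?_⟩
  simp only [Realize, realize_ren]
  refine forall_congr' fun a => ?_
  have := h (fun i => Nat.casesOn i a s)
  rw [show P s a ↔ _ from this]
  refine iff_of_eq (congrArg _ ?_)
  funext i
  rcases hτ : τ i with k | c
  · cases k with
    | zero => simp
    | succ k => simp [hτ]
  · simp [hτ]

theorem defP_congr {P Q : (ℕ → M) → Prop} (hP : DefP E P) (h : ∀ s, Q s ↔ P s) : DefP E Q := by
  have : Q = P := funext fun s => propext (h s)
  rw [this]; exact hP

instance defP_true : DefP E (fun _ => True) :=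
  defP_congr (P := fun _ => False → False) inferInstance (fun s => by simp)

instance defP_not {P : (ℕ → M) → Prop} [hP : DefP E P] : DefP E (fun s => ¬ P s) :=
  defP_congr (P := fun s => P s → False) inferInstance (fun _ => Iff.rfl)

instance defP_and {P Q : (ℕ → M) → Prop} [hP : DefP E P] [hQ : DefP E Q] :
    DefP E (fun s => P s ∧ Q s) :=
  defP_congr (P := fun s => ¬ (P s → ¬ Q s)) inferInstance (fun s => by tauto)

instance defP_or {P Q : (ℕ → M) → Prop} [hP : DefP E P] [hQ : DefP E Q] :
    DefP E (fun s => P s ∨ Q s) :=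
  defP_congr (P := fun s => (¬ P s → Q s)) inferInstance (fun s => by tauto)

instance defP_iff {P Q : (ℕ → M) → Prop} [hP : DefP E P] [hQ : DefP E Q] :
    DefP E (fun s => P s ↔ Q s) :=
  defP_congr (P := fun s => (P s → Q s) ∧ (Q s → P s)) inferInstance (fun s => by tauto)

instance defP_ex {P : (ℕ → M) → M → Prop}
    [hP : DefP E (fun s => P (fun i => s (i + 1)) (s 0))] :
    DefP E (fun s => ∃ a, P s a) :=
  defP_congr (P := fun s => ¬ ∀ a, ¬ P s a) inferInstance (fun s => by simp)

theorem defP_subst {P : (ℕ → M) → Prop} (hP : DefP E P) (t : ℕ → (ℕ → M) → M)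
    (ht : ∀ i, DefT (t i)) : DefP E (fun s => P (fun i => t i s)) := by
  classical
  obtain ⟨n, φ, τ, h⟩ := hP.out
  choose c hc using fun i => (ht i).out
  refine ⟨n, φ, fun i => Sum.elim c .inr (τ i), fun s => ?_⟩
  rw [h]
  refine iff_of_eq (congrArg _ ?_)
  funext i
  rcases hτ : τ i with k | d
  · simp [hc, hτ]
  · simp [hτ]

instance defP_rel2 {R : M → M → Prop} [hR : Def2 E R] {t u : (ℕ → M) → M}
    [ht : DefT t] [hu : DefT u] : DefP E (fun s => R (t s) (u s)) :=
  defP_subst hR.out (fun i => if i = 0 then t else u) (fun i => by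
    by_cases h : i = 0 <;> simp [h] <;> assumption)

theorem def2_of {R : M → M → Prop} (h : DefP E (fun s => R (s 0) (s 1))) : Def2 E R := ⟨h⟩

theorem to1 {P : M → Prop} (hP : DefP E (fun s => P (s 0))) (a : M) :
    ∃ (k : ℕ) (φ : SetFormula (k + 1)) (p : Fin k → M),
      ∀ x, Realize E φ (Fin.cons x p) ↔ P x := by
  classical
  obtain ⟨n, φ, τ, h⟩ := hP.out
  refine ⟨n, ren φ (fun i => if τ i = .inl 0 then 0 else i.succ),
    fun i => Sum.elim (fun _ => a) id (τ i), fun x => ?_⟩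
  have := h (fun i => if i = 0 then x else a)
  simp only at this
  rw [realize_ren, show P x ↔ _ from this]
  refine iff_of_eq (congrArg _ ?_)
  funext i
  rcases hτ : τ i with k | d
  · cases k <;> simp [hτ]
  · simp [hτ]

theorem to2 {P : M → M → Prop} (hP : DefP E (fun s => P (s 0) (s 1))) (a : M) :
    ∃ (k : ℕ) (φ : SetFormula (k + 2)) (p : Fin k → M),
      ∀ x y, Realize E φ (Fin.cons x (Fin.cons y p)) ↔ P x y := by
  classical
  obtain ⟨n, φ, τ, h⟩ := hP.out
  refine ⟨n, ren φ (fun i => if τ i = .inl 0 then 0 else if τ i = .inl 1 then 1 else i.succ.succ),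
    fun i => Sum.elim (fun _ => a) id (τ i), fun x y => ?_⟩
  have := h (fun i => if i = 0 then x else if i = 1 then y else a)
  simp only at this
  rw [realize_ren, show P x y ↔ _ from this]
  refine iff_of_eq (congrArg _ ?_)
  funext i
  rcases hτ : τ i with k | d
  · rcases k with _ | _ | k
    · simp [hτ]
    · simp [hτ]
    · simp [hτ]
  · simp [hτ]

end DefClosure

section DefInst
variable {M : Type} {E : M → M → Prop} {t u w : (ℕ → M) → M}

theorem sub1 {P : M → Prop} (h : DefP E (fun s => P (s 0))) (t : (ℕ → M) → M) [ht : DefT t] :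
    DefP E (fun s => P (t s)) :=
  defP_subst h (fun _ => t) (fun _ => ht)

theorem sub2 {P : M → M → Prop} (h : DefP E (fun s => P (s 0) (s 1))) (t u : (ℕ → M) → M)
    [ht : DefT t] [hu : DefT u] : DefP E (fun s => P (t s) (u s)) :=
  have : Def2 E P := ⟨h⟩
  inferInstance

theorem sub3 {P : M → M → M → Prop} (h : DefP E (fun s => P (s 0) (s 1) (s 2)))
    (t u w : (ℕ → M) → M) [ht : DefT t] [hu : DefT u] [hw : DefT w] :
    DefP E (fun s => P (t s) (u s) (w s)) :=
  defP_subst h (fun i => if i = 0 then t else if i = 1 then u else w) (fun i => by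
    split_ifs <;> assumption)

variable [DefT t] [DefT u] [DefT w]

instance defP_trans : DefP E (fun s => TransE E (t s)) :=
  sub1 (by unfold TransE; infer_instance) t
instance defP_ord : DefP E (fun s => OrdE E (t s)) :=
  sub1 (by unfold OrdE; infer_instance) t
instance defP_sub : DefP E (fun s => SubE E (t s) (u s)) :=
  sub2 (by unfold SubE; infer_instance) t u
instance defP_empty : DefP E (fun s => EmptyE E (t s)) :=
  sub1 (by unfold EmptyE; infer_instance) t
instance defP_succ : DefP E (fun s => SuccSpecE E (t s) (u s)) :=
  sub2 (by unfold SuccSpecE; infer_instance) t u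
instance defP_upair : DefP E (fun s => UPairE E (t s) (u s) (w s)) :=
  sub3 (by unfold UPairE; infer_instance) t u w
instance defP_opair : DefP E (fun s => OPairE E (t s) (u s) (w s)) :=
  sub3 (by unfold OPairE; infer_instance) t u w
instance defP_pairmem : DefP E (fun s => PairMemE E (t s) (u s) (w s)) :=
  sub3 (by unfold PairMemE; infer_instance) t u w
instance defP_pow : DefP E (fun s => PowSpecE E (t s) (u s)) :=
  sub2 (by unfold PowSpecE; infer_instance) t u

end DefInst


/-! ## Basic set theory in a model -/

/-- `(M, E)` is a model of ZFC (as a class, for instance inference). -/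
class ZFC {M : Type} (E : M → M → Prop) : Prop where
  out : IsZFCE E

section Basic
variable {M : Type} {E : M → M → Prop} [hZ : ZFC E]

theorem zext {x y : M} (h : ∀ z, E z x ↔ E z y) : x = y := hZ.out.2.1.1 x y h

theorem zpair (a b : M) : ∃ p, UPairE E p a b := hZ.out.2.1.2.1 a b

theorem zunion (a : M) : ∃ u, ∀ z, E z u ↔ ∃ y, E y a ∧ E z y := hZ.out.2.1.2.2.1 a

theorem zpow (a : M) : ∃ p, PowSpecE E p a := hZ.out.2.2.1 a

theorem zfound (a : M) (h : ∃ z, E z a) : ∃ m, E m a ∧ ∀ z, E z a → ¬ E z m :=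
  hZ.out.2.1.2.2.2.2.1 a h

theorem zsep (P : M → Prop) [hP : DefP E (fun s => P (s 0))] (a : M) :
    ∃ s, ∀ z, E z s ↔ E z a ∧ P z := by
  obtain ⟨k, φ, p, h⟩ := to1 hP a
  obtain ⟨s, hs⟩ := hZ.out.2.1.2.2.2.2.2.1 k φ p a
  exact ⟨s, fun z => by rw [hs, h]⟩

theorem zrepl (R : M → M → Prop) [hP : DefP E (fun s => R (s 0) (s 1))] (a : M)
    (hf : ∀ x, E x a → ∀ y y', R x y → R x y' → y = y') :
    ∃ b, ∀ y, E y b ↔ ∃ x, E x a ∧ R x y := by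
  obtain ⟨k, φ, p, h⟩ := to2 hP a
  obtain ⟨s, hs⟩ := hZ.out.2.1.2.2.2.2.2.2 k φ p a (fun x hx y y' h1 h2 =>
    hf x hx y y' ((h _ _).1 h1) ((h _ _).1 h2))
  exact ⟨s, fun z => by rw [hs]; simp only [h]⟩

theorem zempty : ∃ e : M, ∀ z, ¬ E z e := by
  obtain ⟨a⟩ := hZ.out.1
  obtain ⟨s, hs⟩ := zsep (E := E) (fun _ => False) a
  exact ⟨s, fun z hz => ((hs z).1 hz).2⟩

theorem zinsert (a b : M) : ∃ u, ∀ z, E z u ↔ E z a ∨ z = b := by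
  obtain ⟨p, hp⟩ := zpair (E := E) b b
  obtain ⟨q, hq⟩ := zpair (E := E) a p
  obtain ⟨u, hu⟩ := zunion (E := E) q
  refine ⟨u, fun z => ?_⟩
  rw [hu]
  constructor
  · rintro ⟨y, hy, hz⟩
    rcases (hq y).1 hy with rfl | rfl
    · exact Or.inl hz
    · exact Or.inr (by simpa using (hp z).1 hz)
  · rintro (hz | rfl)
    · exact ⟨a, (hq a).2 (Or.inl rfl), hz⟩
    · exact ⟨p, (hq p).2 (Or.inr rfl), (hp _).2 (Or.inl rfl)⟩

theorem zirrefl (x : M) : ¬ E x x := by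
  intro hx
  obtain ⟨p, hp⟩ := zpair (E := E) x x
  obtain ⟨m, hm, hm'⟩ := zfound (E := E) p ⟨x, (hp x).2 (Or.inl rfl)⟩
  have : m = x := by simpa using (hp m).1 hm
  subst this
  exact hm' m hm hx

theorem zasymm {x y : M} (hx : E x y) (hy : E y x) : False := by
  obtain ⟨p, hp⟩ := zpair (E := E) x y
  obtain ⟨m, hm, hm'⟩ := zfound (E := E) p ⟨x, (hp x).2 (Or.inl rfl)⟩
  rcases (hp m).1 hm with rfl | rfl
  · exact hm' y ((hp _).2 (Or.inr rfl)) hy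
  · exact hm' x ((hp _).2 (Or.inl rfl)) hx

theorem upair_uniq {p q a b : M} (hp : UPairE E p a b) (hq : UPairE E q a b) : p = q :=
  zext (E := E) fun z => by rw [hp z, hq z]

theorem opair_ex (x y : M) : ∃ p, OPairE E p x y := by
  obtain ⟨s, hs⟩ := zpair (E := E) x x
  obtain ⟨t, ht⟩ := zpair (E := E) x y
  obtain ⟨p, hp⟩ := zpair (E := E) s t
  exact ⟨p, s, t, hs, ht, hp⟩

theorem opair_uniq {p q x y : M} (hp : OPairE E p x y) (hq : OPairE E q x y) : p = q := by
  obtain ⟨s, t, hs, ht, hp⟩ := hp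
  obtain ⟨s', t', hs', ht', hq⟩ := hq
  obtain rfl := upair_uniq hs hs'
  obtain rfl := upair_uniq ht ht'
  exact upair_uniq hp hq

theorem opair_inj {p x y x' y' : M} (hp : OPairE E p x y) (hq : OPairE E p x' y') :
    x = x' ∧ y = y' := by
  obtain ⟨s, t, hs, ht, hp⟩ := hp
  obtain ⟨s', t', hs', ht', hq⟩ := hq
  have e1 : ∀ z, (z = s ∨ z = t) ↔ (z = s' ∨ z = t') := fun z => by rw [← hp z, hq z]
  have es : ∀ z, E z s ↔ z = x := fun z => by simpa using hs z
  have es' : ∀ z, E z s' ↔ z = x' := fun z => by simpa using hs' z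
  have hx : x = x' := by
    rcases (e1 s).1 (Or.inl rfl) with h | h
    · exact (es' x).1 (h ▸ (es x).2 rfl)
    · have : E x' s := h ▸ (ht' x').2 (Or.inl rfl)
      exact ((es x').1 this).symm
  subst hx
  obtain rfl := upair_uniq hs hs'
  refine ⟨rfl, ?_⟩
  have h1 : E y t := (ht y).2 (Or.inr rfl)
  have h2 : E y' t' := (ht' y').2 (Or.inr rfl)
  rcases (e1 t).1 (Or.inr rfl) with h | h
  · have hy : y = x := (es y).1 (h ▸ h1)
    rcases (e1 t').2 (Or.inr rfl) with h' | h'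
    · rw [hy, (es y').1 (h' ▸ h2)]
    · rcases (ht y').1 (h' ▸ h2) with h3 | h3
      · rw [hy, h3]
      · exact h3.symm
  · subst h
    rcases (ht y').1 h2 with h3 | h3
    · rcases (ht' y).1 h1 with h4 | h4
      · rw [h3, h4]
      · exact h4
    · exact h3.symm

/-- The graph of a definable function on a set, as a set. -/
theorem mkrel (R : M → M → Prop) [hP : DefP E (fun s => R (s 0) (s 1))] (a : M)
    (hf : ∀ x, E x a → ∀ y y', R x y → R x y' → y = y') :
    ∃ f, (∀ p, E p f ↔ ∃ x y, (E x a ∧ R x y) ∧ OPairE E p x y) ∧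
      ∀ x y, PairMemE E f x y ↔ E x a ∧ R x y := by
  have : Def2 E R := ⟨hP⟩
  obtain ⟨f, hF⟩ := zrepl (E := E) (fun x p => ∃ y, R x y ∧ OPairE E p x y) a (by
    rintro x hx p q ⟨y, hy, hp⟩ ⟨y', hy', hq⟩
    obtain rfl := hf x hx y y' hy hy'
    exact opair_uniq hp hq)
  have h1 : ∀ p, E p f ↔ ∃ x y, (E x a ∧ R x y) ∧ OPairE E p x y := fun p => by
    rw [hF]
    constructor
    · rintro ⟨x, hx, y, hy, hp⟩; exact ⟨x, y, ⟨hx, hy⟩, hp⟩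
    · rintro ⟨x, y, ⟨hx, hy⟩, hp⟩; exact ⟨x, hx, y, hy, hp⟩
  refine ⟨f, h1, fun x y => ⟨?_, fun hxy => ?_⟩⟩
  · rintro ⟨p, hp, hpp⟩
    obtain ⟨x', y', hx, hq⟩ := (h1 p).1 hp
    obtain ⟨rfl, rfl⟩ := opair_inj hpp hq
    exact hx
  · obtain ⟨p, hp⟩ := opair_ex (E := E) x y
    exact ⟨p, (h1 p).2 ⟨x, y, hxy, hp⟩, hp⟩

/-! ### Ordinals -/

theorem ord_mem {M : Type} {E : M → M → Prop} {a b : M} (ha : OrdE E a) (hb : E b a) : OrdE E b :=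
  ⟨ha.2 b hb, fun _ hy => ha.2 _ (ha.1 b hb _ hy)⟩

theorem ord_least (P : M → Prop) [hP : DefP E (fun s => P (s 0))] {a : M} (ha : OrdE E a)
    (h : P a) : ∃ b, OrdE E b ∧ P b ∧ ∀ c, E c b → ¬ P c := by
  by_cases hc : ∃ c, E c a ∧ P c
  · obtain ⟨s, hs⟩ := zsep (E := E) P a
    obtain ⟨c, hc⟩ := hc
    obtain ⟨m, hm, hm'⟩ := zfound (E := E) s ⟨c, (hs c).2 hc⟩
    obtain ⟨h1, h2⟩ := (hs m).1 hm
    exact ⟨m, ord_mem ha h1, h2, fun c hc hpc => hm' c ((hs c).2 ⟨ha.1 m h1 c hc, hpc⟩) hc⟩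
  · push Not at hc
    exact ⟨a, ha, h, hc⟩

theorem ord_ind (P : M → Prop) [hP : DefP E (fun s => P (s 0))]
    (h : ∀ a, OrdE E a → (∀ b, E b a → P b) → P a) {a : M} (ha : OrdE E a) : P a := by
  by_contra hn
  have : DefP E (fun s => ¬ P (s 0)) := defP_not
  obtain ⟨b, hb, hb', hc⟩ := ord_least (E := E) (fun x => ¬ P x) ha hn
  exact hb' (h b hb fun c hcb => not_not.1 (hc c hcb))

theorem ord_tri {a b : M} (ha : OrdE E a) (hb : OrdE E b) : E a b ∨ a = b ∨ E b a := by
  by_contra hn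
  obtain ⟨a, ha, ⟨b, hb, hab⟩, hmin⟩ := ord_least (E := E)
    (fun x => ∃ y, OrdE E y ∧ ¬ (E x y ∨ x = y ∨ E y x)) ha ⟨b, hb, hn⟩
  obtain ⟨b, hb, hab, hmin'⟩ := ord_least (E := E)
    (fun y => ¬ (E a y ∨ a = y ∨ E y a)) hb hab
  apply hab
  right; left
  apply zext (E := E)
  intro z
  constructor
  · intro hz
    have := hmin z hz
    push Not at this
    rcases this b hb with h3 | h3 | h3
    · exact h3
    · subst h3; exact absurd (Or.inr (Or.inr hz)) hab
    · exact absurd (Or.inr (Or.inr (ha.1 z hz b h3))) hab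
  · intro hz
    rcases not_not.1 (hmin' z hz) with h3 | h3 | h3
    · exact absurd (Or.inl (hb.1 z hz a h3)) hab
    · subst h3; exact absurd (Or.inl hz) hab
    · exact h3

theorem ord_sub {a b : M} (ha : OrdE E a) (hb : OrdE E b) (h : SubE E a b) : E a b ∨ a = b := by
  rcases ord_tri ha hb with h1 | h1 | h1
  · exact Or.inl h1
  · exact Or.inr h1
  · exact absurd (h b h1) (zirrefl b)

theorem ord_succ (a : M) (ha : OrdE E a) : ∃ s, SuccSpecE E s a ∧ OrdE E s := by
  obtain ⟨s, hs⟩ := zinsert (E := E) a a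
  refine ⟨s, hs, fun y hy z hz => ?_, fun y hy => ?_⟩
  · rcases (hs y).1 hy with h | rfl
    · exact (hs z).2 (Or.inl (ha.1 y h z hz))
    · exact (hs z).2 (Or.inl hz)
  · rcases (hs y).1 hy with h | rfl
    · exact ha.2 y h
    · exact ha.1

theorem ord_bound (a : M) : ∃ g, OrdE E g ∧ ∀ x, E x a → OrdE E x → E x g := by
  obtain ⟨s, hs⟩ := zsep (E := E) (fun x => OrdE E x) a
  obtain ⟨u, hu⟩ := zunion (E := E) s
  have hou : OrdE E u := by
    refine ⟨fun y hy z hz => ?_, fun y hy => ?_⟩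
    · obtain ⟨x, hx, hyx⟩ := (hu y).1 hy
      exact (hu z).2 ⟨x, hx, ((hs x).1 hx).2.1 y hyx z hz⟩
    · obtain ⟨x, hx, hyx⟩ := (hu y).1 hy
      exact ((hs x).1 hx).2.2 y hyx
  obtain ⟨g, hg, hgo⟩ := ord_succ u hou
  refine ⟨g, hgo, fun x hx hxo => ?_⟩
  rw [hg x]
  exact ord_sub hxo hou fun z hz => (hu z).2 ⟨x, (hs x).2 ⟨hx, hxo⟩, hz⟩

/-- Collection of ordinal witnesses. -/
theorem ord_collect (R : M → M → Prop) [hP : DefP E (fun s => R (s 0) (s 1))] (a : M)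
    (h : ∀ x, E x a → ∃ g, OrdE E g ∧ R x g) :
    ∃ g, OrdE E g ∧ ∀ x, E x a → ∃ c, E c g ∧ R x c := by
  have : Def2 E R := ⟨hP⟩
  obtain ⟨b, hb⟩ := zrepl (E := E) (fun x g => OrdE E g ∧ R x g ∧ ∀ c, E c g → ¬ R x c) a (by
    rintro x hx g g' ⟨h1, h2, h3⟩ ⟨h1', h2', h3'⟩
    rcases ord_tri h1 h1' with h4 | h4 | h4
    · exact absurd h2 (h3' _ h4)
    · exact h4
    · exact absurd h2' (h3 _ h4))
  obtain ⟨g, hg, hg'⟩ := ord_bound (E := E) b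
  refine ⟨g, hg, fun x hx => ?_⟩
  obtain ⟨c, hc, hc'⟩ := h x hx
  obtain ⟨d, hd, hd', hd''⟩ := ord_least (E := E) (fun y => R x y) hc hc'
  exact ⟨d, hg' d ((hb d).2 ⟨x, hx, hd, hd', hd''⟩) hd, hd'⟩

theorem zero_or {a e : M} (he : ∀ z, ¬ E z e) (h : ¬ ∃ z, E z a) : a = e :=
  zext (E := E) fun z => ⟨fun hz => absurd ⟨z, hz⟩ h, fun hz => absurd hz (he z)⟩

/-- Existence of a limit ordinal, all of whose elements belong to a given inductive set. -/
theorem ord_limit : ∃ l : M, OrdE E l ∧ (∃ w, E w l) ∧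
    ∀ a, E a l → ∃ s, SuccSpecE E s a ∧ E s l := by
  obtain ⟨I, ⟨e, heI, he⟩, hI⟩ := hZ.out.2.1.2.2.2.1
  obtain ⟨g, hg, hg'⟩ := ord_bound (E := E) I
  have hgI : ¬ E g I := fun h => zirrefl g (hg' g h hg)
  obtain ⟨l, hl, hl', hmin⟩ := ord_least (E := E) (fun x => ¬ E x I) hg hgI
  refine ⟨l, hl, ?_, fun a ha => ?_⟩
  · by_contra hn
    exact hl' (zero_or he hn ▸ heI)
  · obtain ⟨s, hs, hss⟩ := hI a (not_not.1 (hmin a ha))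
    refine ⟨s, hss, ?_⟩
    obtain ⟨s', hs', hso⟩ := ord_succ a (ord_mem hl ha)
    obtain rfl : s = s' := zext (E := E) fun z => by rw [hss z, hs' z]
    rcases ord_tri hso hl with h | h | h
    · exact h
    · exact absurd (h ▸ hs) hl'
    · rcases (hss l).1 h with h | h
      · exact (zasymm h ha).elim
      · subst h; exact (zirrefl l ha).elim

end Basic


/-! ## Transfinite recursion and its applications -/

section Recursion
variable {M : Type} {E : M → M → Prop} [hZ : ZFC E]

/-- `f` is a set of pairs justified by the recursion rule `G`. -/
def Justif {M : Type} (E : M → M → Prop) (G : M → M → Prop) (f : M) : Prop :=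
  ∀ x y, PairMemE E f x y → OrdE E x ∧ (∀ c, E c x → ∃ z, PairMemE E f c z) ∧
    ∃ r, (∀ p, E p r ↔ ∃ c z, (E c x ∧ PairMemE E f c z) ∧ OPairE E p c z) ∧ G r y

/-- The class function obtained by recursion from `G`. -/
def RecF {M : Type} (E : M → M → Prop) (G : M → M → Prop) (x y : M) : Prop :=
  ∃ f, Justif E G f ∧ PairMemE E f x y

instance recF_def {G : M → M → Prop} [Def2 E G] : Def2 E (RecF E G) :=
  ⟨by unfold RecF Justif; infer_instance⟩

theorem recF_uniq {G : M → M → Prop} [Def2 E G]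
    (hG' : ∀ r y y', G r y → G r y' → y = y') {x : M} (hx : OrdE E x) :
    ∀ y y', RecF E G x y → RecF E G x y' → y = y' := by
  refine ord_ind (E := E) (fun x => ∀ y y', RecF E G x y → RecF E G x y' → y = y') ?_ hx
  rintro x hx ih y y' ⟨f, hf, hfy⟩ ⟨f', hf', hfy'⟩
  obtain ⟨-, h2, r, hr, hG⟩ := hf x y hfy
  obtain ⟨-, h2', r', hr', hG1⟩ := hf' x y' hfy'
  have : r = r' := by
    apply zext (E := E)
    intro p
    rw [hr, hr']
    constructor
    · rintro ⟨c, z, ⟨hc, hz⟩, hp⟩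
      obtain ⟨z', hz'⟩ := h2' c hc
      obtain rfl := ih c hc z z' ⟨f, hf, hz⟩ ⟨f', hf', hz'⟩
      exact ⟨c, z, ⟨hc, hz'⟩, hp⟩
    · rintro ⟨c, z, ⟨hc, hz⟩, hp⟩
      obtain ⟨z', hz'⟩ := h2 c hc
      obtain rfl := ih c hc z z' ⟨f', hf', hz⟩ ⟨f, hf, hz'⟩
      exact ⟨c, z, ⟨hc, hz'⟩, hp⟩
  subst this
  exact hG' r y y' hG hG1

theorem recF_ex {G : M → M → Prop} [Def2 E G] (hG : ∀ r, ∃ y, G r y)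
    (hG' : ∀ r y y', G r y → G r y' → y = y') {x : M} (hx : OrdE E x) :
    ∃ y, RecF E G x y := by
  refine ord_ind (E := E) (fun x => ∃ y, RecF E G x y) ?_ hx
  intro x hx ih
  obtain ⟨f0, h0, h0'⟩ := mkrel (E := E) (RecF E G) x
    (fun c hc => recF_uniq hG' (ord_mem hx hc))
  obtain ⟨y, hy⟩ := hG f0
  obtain ⟨q, hq⟩ := opair_ex (E := E) x y
  obtain ⟨f, hf⟩ := zinsert (E := E) f0 q
  have hpm : ∀ c z, PairMemE E f c z ↔ (E c x ∧ RecF E G c z) ∨ (c = x ∧ z = y) := by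
    intro c z
    rw [← h0']
    constructor
    · rintro ⟨p, hp, hpp⟩
      rcases (hf p).1 hp with h | rfl
      · exact Or.inl ⟨p, h, hpp⟩
      · exact Or.inr (opair_inj hpp hq)
    · rintro (⟨p, hp, hpp⟩ | ⟨rfl, rfl⟩)
      · exact ⟨p, (hf p).2 (Or.inl hp), hpp⟩
      · exact ⟨q, (hf q).2 (Or.inr rfl), hq⟩
  refine ⟨y, f, ?_, (hpm x y).2 (Or.inr ⟨rfl, rfl⟩)⟩
  intro c z hcz
  rcases (hpm c z).1 hcz with ⟨hc, hz⟩ | ⟨rfl, rfl⟩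
  · refine ⟨ord_mem hx hc, fun d hd => ?_, ?_⟩
    · have hdx := hx.1 c hc d hd
      obtain ⟨z', hz'⟩ := ih d hdx
      exact ⟨z', (hpm d z').2 (Or.inl ⟨hdx, hz'⟩)⟩
    · obtain ⟨g, hg, hgz⟩ := hz
      obtain ⟨-, h2, r, hr, hGr⟩ := hg c z hgz
      refine ⟨r, fun p => ?_, hGr⟩
      rw [hr]
      constructor
      · rintro ⟨d, w, ⟨hd, hw⟩, hp⟩
        exact ⟨d, w, ⟨hd, (hpm d w).2 (Or.inl ⟨hx.1 c hc d hd, g, hg, hw⟩)⟩, hp⟩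
      · rintro ⟨d, w, ⟨hd, hw⟩, hp⟩
        refine ⟨d, w, ⟨hd, ?_⟩, hp⟩
        rcases (hpm d w).1 hw with ⟨hdx, hw⟩ | ⟨rfl, rfl⟩
        · obtain ⟨w', hw'⟩ := h2 d hd
          obtain rfl := recF_uniq hG' (ord_mem hx hdx) w w' hw ⟨g, hg, hw'⟩
          exact hw'
        · exact (zasymm hc hd).elim
  · refine ⟨hx, fun d hd => ?_, f0, fun p => ?_, hy⟩
    · obtain ⟨z', hz'⟩ := ih d hd
      exact ⟨z', (hpm d z').2 (Or.inl ⟨hd, hz'⟩)⟩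
    · rw [h0]
      constructor
      · rintro ⟨d, w, ⟨hd, hw⟩, hp⟩
        exact ⟨d, w, ⟨hd, (hpm d w).2 (Or.inl ⟨hd, hw⟩)⟩, hp⟩
      · rintro ⟨d, w, ⟨hd, hw⟩, hp⟩
        rcases (hpm d w).1 hw with ⟨-, hw⟩ | ⟨rfl, rfl⟩
        · exact ⟨d, w, ⟨hd, hw⟩, hp⟩
        · exact (zirrefl _ hd).elim

theorem zrec (G : M → M → Prop) [hGd : DefP E (fun s => G (s 0) (s 1))] (hG : ∀ r, ∃ y, G r y)
    (hG' : ∀ r y y', G r y → G r y' → y = y') :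
    ∃ F : M → M → Prop, Def2 E F ∧ (∀ x, OrdE E x → ∃ y, F x y) ∧
      (∀ x, OrdE E x → ∀ y y', F x y → F x y' → y = y') ∧
      ∀ x, OrdE E x → ∃ r, (∀ c z, PairMemE E r c z ↔ E c x ∧ F c z) ∧
        ∀ y, F x y → G r y := by
  have : Def2 E G := ⟨hGd⟩
  refine ⟨RecF E G, inferInstance, fun x hx => recF_ex hG hG' hx,
    fun x hx => recF_uniq hG' hx, fun x hx => ?_⟩
  obtain ⟨r, hr, hr'⟩ := mkrel (E := E) (RecF E G) x
    (fun c hc => recF_uniq hG' (ord_mem hx hc))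
  refine ⟨r, hr', fun y hy => ?_⟩
  obtain ⟨f, hf, hfy⟩ := hy
  obtain ⟨-, h2, r', hr1, hG1⟩ := hf x y hfy
  have : r = r' := by
    apply zext (E := E)
    intro p
    rw [hr, hr1]
    constructor
    · rintro ⟨c, z, ⟨hc, hz⟩, hp⟩
      obtain ⟨z', hz'⟩ := h2 c hc
      obtain rfl := recF_uniq hG' (ord_mem hx hc) z z' hz ⟨f, hf, hz'⟩
      exact ⟨c, z, ⟨hc, hz'⟩, hp⟩
    · rintro ⟨c, z, ⟨hc, hz⟩, hp⟩
      exact ⟨c, z, ⟨hc, f, hf, hz⟩, hp⟩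
  rw [this]; exact hG1

/-- The set of all second coordinates of pairs in `r`, up to superset. -/
theorem zrange (r : M) : ∃ u, ∀ c z, PairMemE E r c z → E z u := by
  obtain ⟨u, hu⟩ := zunion (E := E) r
  obtain ⟨v, hv⟩ := zunion (E := E) u
  refine ⟨v, ?_⟩
  rintro c z ⟨p, hp, s, t, hs, ht, hpp⟩
  exact (hv z).2 ⟨t, (hu t).2 ⟨p, hp, (hpp t).2 (Or.inr rfl)⟩, (ht z).2 (Or.inr rfl)⟩

theorem zbig (x y : M) : ∃ u, ∀ z, E z u ↔ E z x ∨ E z y := by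
  obtain ⟨p, hp⟩ := zpair (E := E) x y
  obtain ⟨u, hu⟩ := zunion (E := E) p
  refine ⟨u, fun z => ?_⟩
  rw [hu]
  constructor
  · rintro ⟨w, hw, hz⟩
    rcases (hp w).1 hw with rfl | rfl
    · exact Or.inl hz
    · exact Or.inr hz
  · rintro (hz | hz)
    · exact ⟨x, (hp x).2 (Or.inl rfl), hz⟩
    · exact ⟨y, (hp y).2 (Or.inr rfl), hz⟩

theorem ztc (x : M) : ∃ t, TransE E t ∧ SubE E x t := by
  obtain ⟨F, hFd, hF1, hF2, hF3⟩ := zrec (E := E)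
    (fun r y => ∀ z, E z y ↔ E z x ∨ ∃ c v w, PairMemE E r c v ∧ E w v ∧ E z w)
    (fun r => by
      obtain ⟨u, hu⟩ := zrange (E := E) r
      obtain ⟨u1, hu1⟩ := zunion (E := E) u
      obtain ⟨u2, hu2⟩ := zunion (E := E) u1
      obtain ⟨b, hb⟩ := zbig (E := E) x u2
      obtain ⟨y, hy⟩ := zsep (E := E)
        (fun z => E z x ∨ ∃ c v w, PairMemE E r c v ∧ E w v ∧ E z w) b
      refine ⟨y, fun z => ?_⟩
      rw [hy, and_iff_right_iff_imp, hb]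
      rintro (h | ⟨c, v, w, h1, h2, h3⟩)
      · exact Or.inl h
      · exact Or.inr ((hu2 z).2 ⟨w, (hu1 w).2 ⟨v, hu c v h1, h2⟩, h3⟩))
    (fun r y y' h h' => zext (E := E) fun z => by rw [h, h'])
  obtain ⟨l, hl, ⟨e, he⟩, hls⟩ := ord_limit (E := E)
  obtain ⟨t, ht⟩ := hF1 l hl
  obtain ⟨r, hr, hrG⟩ := hF3 l hl
  have htt := hrG t ht
  refine ⟨t, ?_, fun z hz => (htt z).2 (Or.inl hz)⟩
  intro w hw z hz
  have key : ∃ c, E c l ∧ ∃ v, F c v ∧ E w v := by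
    rcases (htt w).1 hw with h | ⟨c, v, w', h1, h2, h3⟩
    · obtain ⟨v, hv⟩ := hF1 e (ord_mem hl he)
      obtain ⟨r', hr', hrG'⟩ := hF3 e (ord_mem hl he)
      exact ⟨e, he, v, hv, (hrG' v hv w).2 (Or.inl h)⟩
    · obtain ⟨h1, h4⟩ := (hr c v).1 h1
      obtain ⟨s, hs, hsl⟩ := hls c h1
      obtain ⟨v', hv'⟩ := hF1 s (ord_mem hl hsl)
      obtain ⟨r', hr', hrG'⟩ := hF3 s (ord_mem hl hsl)
      exact ⟨s, hsl, v', hv', (hrG' v' hv' w).2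
        (Or.inr ⟨c, v, w', (hr' c v).2 ⟨(hs c).2 (Or.inr rfl), h4⟩, h2, h3⟩)⟩
  obtain ⟨c, hc, v, hv, hwv⟩ := key
  exact (htt z).2 (Or.inr ⟨c, v, w, (hr c v).2 ⟨hc, hv⟩, hwv, hz⟩)

/-- The cumulative hierarchy. -/
structure IsHier {M : Type} (E : M → M → Prop) (V : M → M → Prop) : Prop where
  dfn : Def2 E V
  set : ∀ a, OrdE E a → ∃ v, ∀ x, E x v ↔ V x a
  spec : ∀ a, OrdE E a → ∀ x, V x a ↔ ∃ b, E b a ∧ ∀ z, E z x → V z b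

theorem hier_ex : ∃ V : M → M → Prop, IsHier E V := by
  obtain ⟨F, hFd, hF1, hF2, hF3⟩ := zrec (E := E)
    (fun r y => ∀ z, E z y ↔ ∃ c v, PairMemE E r c v ∧ SubE E z v)
    (fun r => by
      obtain ⟨u, hu⟩ := zrange (E := E) r
      obtain ⟨u1, hu1⟩ := zunion (E := E) u
      obtain ⟨p, hp⟩ := zpow (E := E) u1
      obtain ⟨y, hy⟩ := zsep (E := E) (fun z => ∃ c v, PairMemE E r c v ∧ SubE E z v) p
      refine ⟨y, fun z => ?_⟩
      rw [hy, and_iff_right_iff_imp, hp z]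
      rintro ⟨c, v, h1, h2⟩
      exact fun w hw => (hu1 w).2 ⟨v, hu c v h1, h2 w hw⟩)
    (fun r y y' h h' => zext (E := E) fun z => by rw [h, h'])
  refine ⟨fun x a => ∃ v, F a v ∧ E x v, ⟨inferInstance⟩, fun a ha => ?_, fun a ha x => ?_⟩
  · obtain ⟨v, hv⟩ := hF1 a ha
    refine ⟨v, fun x => ⟨fun hx => ⟨v, hv, hx⟩, ?_⟩⟩
    rintro ⟨v', hv', hx⟩
    rwa [hF2 a ha v v' hv hv']
  · obtain ⟨r, hr, hrG⟩ := hF3 a ha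
    constructor
    · rintro ⟨v, hv, hx⟩
      obtain ⟨b, w, h1, h2⟩ := (hrG v hv x).1 hx
      obtain ⟨h1, h3⟩ := (hr b w).1 h1
      exact ⟨b, h1, fun z hz => ⟨w, h3, h2 z hz⟩⟩
    · rintro ⟨b, hb, h⟩
      obtain ⟨v, hv⟩ := hF1 a ha
      obtain ⟨w, hw⟩ := hF1 b (ord_mem ha hb)
      refine ⟨v, hv, (hrG v hv x).2 ⟨b, w, (hr b w).2 ⟨hb, hw⟩, fun z hz => ?_⟩⟩
      obtain ⟨w', hw', hz'⟩ := h z hz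
      rwa [hF2 b (ord_mem ha hb) w w' hw hw']

theorem hier_mono {V : M → M → Prop} (hV : IsHier E V) {x a b : M} (hb : OrdE E b) (hab : E a b)
    (hx : V x a) : V x b := by
  obtain ⟨c, hc, h⟩ := (hV.spec a (ord_mem hb hab) x).1 hx
  exact (hV.spec b hb x).2 ⟨c, hb.1 a hab c hc, h⟩

theorem hier_trans {V : M → M → Prop} (hV : IsHier E V) {x a z : M} (ha : OrdE E a)
    (hx : V x a) (hz : E z x) : V z a := by
  obtain ⟨c, hc, h⟩ := (hV.spec a ha x).1 hx
  exact hier_mono hV ha hc (h z hz)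

theorem hier_rank {V : M → M → Prop} (hV : IsHier E V) (x : M) : ∃ a, OrdE E a ∧ V x a := by
  have := hV.dfn
  by_contra hn
  obtain ⟨t, ht, hxt⟩ := ztc (E := E) x
  obtain ⟨t', ht'⟩ := zinsert (E := E) t x
  obtain ⟨s, hs⟩ := zsep (E := E) (fun y => ¬ ∃ a, OrdE E a ∧ V y a) t'
  obtain ⟨m, hm, hmin⟩ := zfound (E := E) s ⟨x, (hs x).2 ⟨(ht' x).2 (Or.inr rfl), hn⟩⟩
  obtain ⟨h1, h2⟩ := (hs m).1 hm
  apply h2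
  have h3 : ∀ z, E z m → ∃ a, OrdE E a ∧ V z a := by
    intro z hz
    by_contra hz'
    have : E z t := by
      rcases (ht' m).1 h1 with h | rfl
      · exact ht m h z hz
      · exact hxt z hz
    exact hmin z ((hs z).2 ⟨(ht' z).2 (Or.inl this), hz'⟩) hz
  obtain ⟨g, hg, hg'⟩ := ord_collect (E := E) (fun z a => V z a) m h3
  obtain ⟨g', hgs, hgo⟩ := ord_succ g hg
  refine ⟨g', hgo, (hV.spec g' hgo m).2 ⟨g, (hgs g).2 (Or.inr rfl), fun z hz => ?_⟩⟩
  obtain ⟨c, hc, hcz⟩ := hg' z hz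
  exact hier_mono hV hg hc hcz

/-- Every set is the image of an ordinal. -/
theorem zwo (x : M) : ∃ a r, OrdE E a ∧
    (∀ c z z', E c a → PairMemE E r c z → PairMemE E r c z' → z = z') ∧
    ∀ z, E z x → ∃ c, E c a ∧ PairMemE E r c z := by
  -- a choice function
  have hch : ∃ c : M, ∀ u, SubE E u x → (∃ z, E z u) →
      ∃ y, (E y u ∧ PairMemE E c u y) ∧ ∀ y', E y' u → PairMemE E c u y' → y' = y := by
    obtain ⟨px, hpx⟩ := zpow (E := E) x
    obtain ⟨a, ha⟩ := zrepl (E := E)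
      (fun u w => (∃ z, E z u) ∧ ∀ p, E p w ↔ ∃ z, E z u ∧ OPairE E p u z) px (by
        rintro u - w w' ⟨-, h⟩ ⟨-, h'⟩
        exact zext (E := E) fun p => by rw [h, h'])
    obtain ⟨c, hc⟩ := hZ.out.2.2.2 a (by
      intro w hw
      obtain ⟨u, -, ⟨z, hz⟩, h⟩ := (ha w).1 hw
      obtain ⟨p, hp⟩ := opair_ex (E := E) u z
      exact ⟨p, (h p).2 ⟨z, hz, hp⟩⟩) (by
      rintro w w' hw hw' hne ⟨p, hp, hp'⟩
      obtain ⟨u, -, -, h⟩ := (ha w).1 hw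
      obtain ⟨u', -, -, h'⟩ := (ha w').1 hw'
      obtain ⟨z, hz, hpz⟩ := (h p).1 hp
      obtain ⟨z', hz', hpz'⟩ := (h' p).1 hp'
      obtain ⟨rfl, rfl⟩ := opair_inj hpz hpz'
      exact hne (zext (E := E) fun p => by rw [h, h']))
    refine ⟨c, fun u hu hne => ?_⟩
    obtain ⟨w, hw⟩ : ∃ w, ∀ p, E p w ↔ ∃ z, E z u ∧ OPairE E p u z :=
      zrepl (E := E) (fun z p => OPairE E p u z) u (fun z _ p q hp hq => opair_uniq hp hq)
    obtain ⟨p, hpc, hpw, huniq⟩ := hc w ((ha w).2 ⟨u, (hpx u).2 hu, hne, hw⟩)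
    obtain ⟨y, hy, hp⟩ := (hw p).1 hpw
    refine ⟨y, ⟨hy, p, hpc, hp⟩, ?_⟩
    rintro y' hy' ⟨q, hq, hq'⟩
    have := huniq q hq ((hw q).2 ⟨y', hy', hq'⟩)
    subst this
    exact (opair_inj hq' hp).2
  obtain ⟨c, hc⟩ := hch
  obtain ⟨F, hFd, hF1, hF2, hF3⟩ := zrec (E := E)
    (fun r y => (∃ u, (∃ z, E z u) ∧ (∀ z, E z u ↔ E z x ∧ ¬ ∃ d, PairMemE E r d z) ∧
        E y u ∧ PairMemE E c u y) ∨ ((∀ z, E z x → ∃ d, PairMemE E r d z) ∧ y = x))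
    (fun r => by
      by_cases h : ∀ z, E z x → ∃ d, PairMemE E r d z
      · exact ⟨x, Or.inr ⟨h, rfl⟩⟩
      · push Not at h
        obtain ⟨z, hz, hzd⟩ := h
        obtain ⟨u, hu⟩ := zsep (E := E) (fun z => ¬ ∃ d, PairMemE E r d z) x
        have hne : ∃ z, E z u := ⟨z, (hu z).2 ⟨hz, fun ⟨d, hd⟩ => hzd d hd⟩⟩
        obtain ⟨y, hy, -⟩ := hc u (fun w hw => ((hu w).1 hw).1) hne
        exact ⟨y, Or.inl ⟨u, hne, hu, hy⟩⟩)
    (by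
      rintro r y y' (⟨u, hne, hu, hy, hcy⟩ | ⟨h, rfl⟩) (⟨u', hne', hu', hy', hcy'⟩ | ⟨h', rfl⟩)
      · obtain rfl : u = u' := zext (E := E) fun z => by rw [hu, hu']
        obtain ⟨y0, -, hun⟩ := hc u (fun w hw => ((hu w).1 hw).1) hne
        rw [hun y hy hcy, hun y' hy' hcy']
      · obtain ⟨h1, h2⟩ := (hu y).1 hy
        exact absurd (h' y h1) h2
      · obtain ⟨h1, h2⟩ := (hu' y').1 hy'
        exact absurd (h y' h1) h2
      · rfl)
  by_cases hcase : ∃ a, OrdE E a ∧ F a x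
  · obtain ⟨a, ha, hax⟩ := hcase
    obtain ⟨r, hr, hrG⟩ := hF3 a ha
    refine ⟨a, r, ha, fun d z z' hd h1 h2 => ?_, fun z hz => ?_⟩
    · exact hF2 d (ord_mem ha hd) z z' ((hr d z).1 h1).2 ((hr d z').1 h2).2
    · rcases hrG x hax with ⟨u, hne, hu, hy, hcy⟩ | ⟨h, -⟩
      · exact absurd ((hu x).1 hy).1 (zirrefl x)
      · obtain ⟨d, hd⟩ := h z hz
        exact ⟨d, ((hr d z).1 hd).1, hd⟩
  · exfalso
    have key : ∀ a y, OrdE E a → F a y → E y x ∧ ∀ d, E d a → ¬ F d y := by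
      intro a y ha hy
      obtain ⟨r, hr, hrG⟩ := hF3 a ha
      rcases hrG y hy with ⟨u, hne, hu, hyu, hcy⟩ | ⟨h, rfl⟩
      · obtain ⟨h1, h2⟩ := (hu y).1 hyu
        exact ⟨h1, fun d hd hdy => h2 ⟨d, (hr d y).2 ⟨hd, hdy⟩⟩⟩
      · exact absurd ⟨a, ha, hy⟩ hcase
    obtain ⟨b, hb⟩ := zrepl (E := E) (fun y a => OrdE E a ∧ F a y) x (by
      rintro y - a a' ⟨h1, h2⟩ ⟨h1', h2'⟩
      rcases ord_tri h1 h1' with h | h | h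
      · exact absurd h2 ((key a' y h1' h2').2 a h)
      · exact h
      · exact absurd h2' ((key a y h1 h2).2 a' h))
    obtain ⟨g, hg, hg'⟩ := ord_bound (E := E) b
    obtain ⟨y, hy⟩ := hF1 g hg
    exact zirrefl g (hg' g ((hb g).2 ⟨y, (key g y hg hy).1, hg, hy⟩) hg)

theorem ord_ub {a b : M} (ha : OrdE E a) (hb : OrdE E b) :
    ∃ c, OrdE E c ∧ SubE E a c ∧ SubE E b c := by
  rcases ord_tri ha hb with h | rfl | h
  · exact ⟨b, hb, fun z hz => hb.1 a h z hz, fun z hz => hz⟩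
  · exact ⟨a, ha, fun z hz => hz, fun z hz => hz⟩
  · exact ⟨a, ha, fun z hz => hz, fun z hz => ha.1 b h z hz⟩

/-- Closure points of a total relation on ordinals are unbounded. -/
theorem club_unbounded (R : M → M → Prop) [hR : Def2 E R]
    (h : ∀ b, OrdE E b → ∃ g, OrdE E g ∧ R b g) {a0 : M} (ha0 : OrdE E a0) :
    ∃ a, OrdE E a ∧ E a0 a ∧ (∀ b, E b a → ∃ c, E c a ∧ E b c) ∧
      ∀ b, E b a → ∃ g, E g a ∧ R b g := by
  obtain ⟨F, hFd, hF1, hF2, hF3⟩ := zrec (E := E)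
    (fun r y => OrdE E y ∧ (E a0 y ∧ ∀ n v, PairMemE E r n v → OrdE E v →
        E v y ∧ ∀ b, E b v → ∃ g, E g y ∧ R b g) ∧
      ∀ y', E y' y → ¬ (E a0 y' ∧ ∀ n v, PairMemE E r n v → OrdE E v →
        E v y' ∧ ∀ b, E b v → ∃ g, E g y' ∧ R b g))
    (fun r => by
      obtain ⟨u, hu⟩ := zrange (E := E) r
      obtain ⟨u1, hu1⟩ := zunion (E := E) u
      obtain ⟨w, hw⟩ := zsep (E := E) (fun b => OrdE E b) u1
      obtain ⟨g1, hg1, hg1'⟩ := ord_collect (E := E) R w (fun b hb => h b ((hw b).1 hb).2)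
      obtain ⟨g2, hg2, hg2'⟩ := ord_bound (E := E) u
      obtain ⟨g3, hg3', hg3⟩ := ord_succ a0 ha0
      obtain ⟨g4, hg4, h14, h24⟩ := ord_ub hg1 hg2
      obtain ⟨g5, hg5, h35, h45⟩ := ord_ub hg3 hg4
      obtain ⟨y, hy, hy1, hy2⟩ := ord_least (E := E) (fun y =>
        (E a0 y ∧ ∀ n v, PairMemE E r n v → OrdE E v →
          E v y ∧ ∀ b, E b v → ∃ g, E g y ∧ R b g)) hg5 (by
        refine ⟨h35 _ ((hg3' a0).2 (Or.inr rfl)), fun n v hnv hv => ⟨?_, fun b hb => ?_⟩⟩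
        · exact h45 _ (h24 _ (hg2' v (hu n v hnv) hv))
        · obtain ⟨g, hg, hgR⟩ := hg1' b
            ((hw b).2 ⟨(hu1 b).2 ⟨v, hu n v hnv, hb⟩, ord_mem hv hb⟩)
          exact ⟨g, h45 _ (h14 _ hg), hgR⟩)
      exact ⟨y, hy, hy1, hy2⟩)
    (by
      rintro r y y' ⟨h1, h2, h3⟩ ⟨h1', h2', h3'⟩
      rcases ord_tri h1 h1' with h4 | h4 | h4
      · exact absurd h2 (h3' y h4)
      · exact h4
      · exact absurd h2' (h3 y' h4))
  obtain ⟨l, hl, ⟨e, he⟩, hls⟩ := ord_limit (E := E)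
  have hFo : ∀ n v, OrdE E n → F n v → OrdE E v := by
    intro n v hn hv
    obtain ⟨r, hr, hrG⟩ := hF3 n hn
    exact (hrG v hv).1
  have hFa : ∀ n v, OrdE E n → F n v → E a0 v := by
    intro n v hn hv
    obtain ⟨r, hr, hrG⟩ := hF3 n hn
    exact (hrG v hv).2.1.1
  have hstep : ∀ n m v w, E n m → OrdE E m → F n v → F m w →
      E v w ∧ ∀ b, E b v → ∃ g, E g w ∧ R b g := by
    intro n m v w hnm hm hv hw
    obtain ⟨r, hr, hrG⟩ := hF3 m hm
    exact (hrG w hw).2.1.2 n v ((hr n v).2 ⟨hnm, hv⟩) (hFo n v (ord_mem hm hnm) hv)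
  obtain ⟨a, ha⟩ := hF1 l hl
  have hao := hFo l a hl ha
  have hsup : ∀ c, E c a → ∃ n v, E n l ∧ F n v ∧ E c v := by
    intro c hc
    by_contra hn
    push Not at hn
    have hco := ord_mem hao hc
    have hsub : ∀ n v, E n l → F n v → SubE E v c := by
      intro n v hnl hv
      have := hn n v hnl hv
      have hvo := hFo n v (ord_mem hl hnl) hv
      rcases ord_tri hvo hco with h1 | h1 | h1
      · exact fun z hz => hco.1 v h1 z hz
      · subst h1; exact fun z hz => hz
      · exact absurd h1 this
    obtain ⟨r, hr, hrG⟩ := hF3 l hl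
    apply (hrG a ha).2.2 c hc
    refine ⟨?_, fun n v hnv hv => ?_⟩
    · obtain ⟨v, hv⟩ := hF1 e (ord_mem hl he)
      exact hsub e v he hv _ (hFa e v (ord_mem hl he) hv)
    · obtain ⟨h1, h2⟩ := (hr n v).1 hnv
      obtain ⟨s, hs, hsl⟩ := hls n h1
      obtain ⟨w, hw⟩ := hF1 s (ord_mem hl hsl)
      obtain ⟨h3, h4⟩ := hstep n s v w ((hs n).2 (Or.inr rfl)) (ord_mem hl hsl) h2 hw
      refine ⟨hsub s w hsl hw _ h3, fun b hb => ?_⟩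
      obtain ⟨g, hg, hgR⟩ := h4 b hb
      exact ⟨g, hsub s w hsl hw _ hg, hgR⟩
  refine ⟨a, hao, hFa l a hl ha, fun b hb => ?_, fun b hb => ?_⟩
  · obtain ⟨n, v, hn, hv, hbv⟩ := hsup b hb
    exact ⟨v, (hstep n l v a hn hl hv ha).1, hbv⟩
  · obtain ⟨n, v, hn, hv, hbv⟩ := hsup b hb
    exact (hstep n l v a hn hl hv ha).2 b hbv

end Recursion


/-! ## Relativized satisfaction and good models -/

/-- Satisfaction with quantifiers restricted to `S`. -/
def RelR {M : Type} (E : M → M → Prop) (S : M → Prop) :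
    ∀ {n : ℕ}, SetFormula n → (Fin n → M) → Prop
  | _, .mem i j, v => E (v i) (v j)
  | _, .eq i j, v => v i = v j
  | _, .fal, _ => False
  | _, .imp φ ψ, v => RelR E S φ v → RelR E S ψ v
  | n, .all φ, v => ∀ a, S a → RelR E S φ (Fin.snoc (α := fun _ : Fin (n + 1) => M) v a)

theorem relR_iff {M : Type} {E : M → M → Prop} {S : M → Prop} : ∀ {n : ℕ} (φ : SetFormula n)
    (v : Fin n → {x // S x}), RelR E S φ (fun i => (v i).1) ↔
      Realize (fun a b : {x // S x} => E a.1 b.1) φ v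
  | _, .mem i j, v => Iff.rfl
  | _, .eq i j, v => by simp only [RelR, Realize]; exact Subtype.ext_iff.symm
  | _, .fal, v => Iff.rfl
  | _, .imp φ ψ, v => by simp only [RelR, Realize, relR_iff φ, relR_iff ψ]
  | n, .all φ, v => by
      simp only [RelR, Realize, Subtype.forall]
      refine forall_congr' fun a => forall_congr' fun ha => ?_
      rw [← relR_iff φ]
      refine iff_of_eq (congrArg _ ?_)
      funext i
      refine Fin.lastCases ?_ (fun j => ?_) i <;> simp

/-- The structure induced on the elements of `m`. -/
def SE {M : Type} (E : M → M → Prop) (m : M) : {x // E x m} → {x // E x m} → Prop :=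
  fun a b => E a.1 b.1

theorem relR_sub {M : Type} {E : M → M → Prop} {m : M} (hm : TransE E m) (m' : {x // E x m}) :
    ∀ {n : ℕ} (φ : SetFormula n)
    (v : Fin n → {x // E x m}), RelR (SE E m) (fun x => SE E m x m') φ v ↔
      RelR E (fun x => E x m'.1) φ (fun i => (v i).1)
  | _, .mem i j, v => Iff.rfl
  | _, .eq i j, v => by simp only [RelR]; exact Subtype.ext_iff
  | _, .fal, v => Iff.rfl
  | _, .imp φ ψ, v => by simp only [RelR, relR_sub hm m' φ, relR_sub hm m' ψ]
  | n, .all φ, v => by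
      simp only [RelR, relR_sub hm m' φ, Subtype.forall]
      have e : ∀ (a : M) (ha : E a m),
          (fun i => ((Fin.snoc (α := fun _ : Fin (n + 1) => {x // E x m}) v ⟨a, ha⟩) i).1)
          = (Fin.snoc (α := fun _ : Fin (n + 1) => M) (fun i => (v i).1) a) := by
        intro a ha
        funext i
        refine Fin.lastCases ?_ (fun j => ?_) i <;> simp
      constructor
      · intro h a ha
        have ham : E a m := hm _ m'.2 a ha
        rw [← e a ham]
        exact h a ham ha
      · intro h a ha ha'
        rw [e a ha]
        exact h a ha'

theorem defP_relR0 {M : Type} {E : M → M → Prop} : ∀ {n : ℕ} (φ : SetFormula n),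
    DefP E (fun s => RelR E (fun x => E x (s 0)) φ (fun i => s (i + 1)))
  | _, .mem i j => by simp only [RelR]; infer_instance
  | _, .eq i j => by simp only [RelR]; infer_instance
  | _, .fal => by simp only [RelR]; infer_instance
  | _, .imp φ ψ => by
      simp only [RelR]
      have := defP_relR0 (E := E) φ
      have := defP_relR0 (E := E) ψ
      infer_instance
  | n, .all φ => by
      simp only [RelR]
      have h := defP_relR0 (E := E) φ
      have h2 : DefP E (fun s : ℕ → M => RelR E (fun x => E x (s 1)) φ
          (Fin.snoc (α := fun _ : Fin (n + 1) => M) (fun i => s (i + 1 + 1)) (s 0))) := by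
        have := defP_subst h (fun k s => if k = 0 then s 1 else if k = n + 1 then s 0 else s (k + 1))
          (fun i => by split_ifs <;> infer_instance)
        refine defP_congr this fun s => ?_
        simp only [if_true]
        refine iff_of_eq (congrArg _ ?_)
        funext i
        refine Fin.lastCases ?_ (fun j => ?_) i
        · simp
        · have : (j : ℕ) ≠ n := j.2.ne
          simp [this]
      refine @defP_all M E _ ?_
      exact @defP_imp M E _ _ inferInstance h2

theorem defP_relR {M : Type} {E : M → M → Prop} {n : ℕ} (φ : SetFormula n)
    (t : (ℕ → M) → M) [ht : DefT t] (u : Fin n → (ℕ → M) → M) (hu : ∀ i, DefT (u i)) :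
    DefP E (fun s => RelR E (fun x => E x (t s)) φ (fun i => u i s)) := by
  have := defP_subst (defP_relR0 (E := E) φ)
    (fun k s => if k = 0 then t s else if h : k - 1 < n then u ⟨k - 1, h⟩ s else t s)
    (fun i => by split_ifs <;> [exact ht; exact hu _; exact ht])
  refine defP_congr this fun s => ?_
  simp

/-- `m` is a (second-order) model of `ZFC + φ`. -/
def Good {M : Type} (E : M → M → Prop) (φ : SetFormula 0) (m : M) : Prop :=
  TransE E m ∧ (∀ x, E x m → ∀ y, SubE E y x → E y m) ∧
  (∀ a b, E a m → E b m → ∃ p, E p m ∧ UPairE E p a b) ∧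
  (∀ a, E a m → ∃ u, E u m ∧ ∀ z, E z u ↔ ∃ y, E y a ∧ E z y) ∧
  (∀ a, E a m → ∃ p, E p m ∧ PowSpecE E p a) ∧
  (∃ I, E I m ∧ (∃ e, E e I ∧ EmptyE E e) ∧ ∀ y, E y I → ∃ s, E s I ∧ SuccSpecE E s y) ∧
  (∀ a f b, E a m → SubE E f m → SubE E b m →
    (∀ x y y', PairMemE E f x y → PairMemE E f x y' → y = y') →
    (∀ y, E y b → ∃ x, E x a ∧ PairMemE E f x y) → E b m) ∧
  RelR E (fun x => E x m) φ ![]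

theorem defP_good {M : Type} {E : M → M → Prop} (φ : SetFormula 0) :
    DefP E (fun s => Good E φ (s 0)) := by
  have h : DefP E (fun s => RelR E (fun x => E x (s 0)) φ ![]) := by
    refine defP_congr (defP_relR φ (fun s => s 0) (fun i => i.elim0) (fun i => i.elim0)) fun s => ?_
    exact iff_of_eq (congrArg _ (funext fun i => i.elim0))
  unfold Good
  repeat' refine @defP_and M E _ _ ?_ ?_
  all_goals first | exact h | infer_instance

section Abs
variable {M : Type} {E : M → M → Prop} {m : M}

theorem abs_upair (hm : TransE E m) (p a b : {x // E x m}) :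
    UPairE (SE E m) p a b ↔ UPairE E p.1 a.1 b.1 := by
  simp only [UPairE, SE, Subtype.forall, Subtype.ext_iff]
  refine forall_congr' fun z => ⟨fun h => ⟨fun hz => (h (hm _ p.2 z hz)).1 hz, fun hz => ?_⟩,
    fun h _ => h⟩
  have : E z m := by rcases hz with rfl | rfl; exacts [a.2, b.2]
  exact (h this).2 hz

theorem abs_opair (hm : TransE E m) (p a b : {x // E x m}) :
    OPairE (SE E m) p a b ↔ OPairE E p.1 a.1 b.1 := by
  constructor
  · rintro ⟨s, t, h1, h2, h3⟩
    exact ⟨s.1, t.1, (abs_upair hm _ _ _).1 h1, (abs_upair hm _ _ _).1 h2, (abs_upair hm _ _ _).1 h3⟩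
  · rintro ⟨s, t, h1, h2, h3⟩
    have hs : E s m := hm _ p.2 s ((h3 s).2 (Or.inl rfl))
    have ht : E t m := hm _ p.2 t ((h3 t).2 (Or.inr rfl))
    exact ⟨⟨s, hs⟩, ⟨t, ht⟩, (abs_upair hm _ _ _).2 h1, (abs_upair hm _ _ _).2 h2,
      (abs_upair hm _ _ _).2 h3⟩

theorem abs_pairmem (hm : TransE E m) (p a b : {x // E x m}) :
    PairMemE (SE E m) p a b ↔ PairMemE E p.1 a.1 b.1 := by
  constructor
  · rintro ⟨q, hq, h⟩
    exact ⟨q.1, hq, (abs_opair hm _ _ _).1 h⟩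
  · rintro ⟨q, hq, h⟩
    exact ⟨⟨q, hm _ p.2 q hq⟩, hq, (abs_opair hm _ _ _).2 h⟩

theorem abs_sub (hm : TransE E m) (a b : {x // E x m}) :
    SubE (SE E m) a b ↔ SubE E a.1 b.1 :=
  ⟨fun h z hz => h ⟨z, hm _ a.2 z hz⟩ hz, fun h z hz => h z.1 hz⟩

theorem abs_empty (hm : TransE E m) (a : {x // E x m}) :
    EmptyE (SE E m) a ↔ EmptyE E a.1 :=
  ⟨fun h z hz => h ⟨z, hm _ a.2 z hz⟩ hz, fun h z hz => h z.1 hz⟩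

theorem abs_succ (hm : TransE E m) (a b : {x // E x m}) :
    SuccSpecE (SE E m) a b ↔ SuccSpecE E a.1 b.1 := by
  simp only [SuccSpecE, SE, Subtype.forall, Subtype.ext_iff]
  refine forall_congr' fun z => ⟨fun h => ⟨fun hz => (h (hm _ a.2 z hz)).1 hz, fun hz => ?_⟩,
    fun h _ => h⟩
  have : E z m := by
    rcases hz with h' | rfl
    exacts [hm _ b.2 z h', b.2]
  exact (h this).2 hz

theorem abs_trans (hm : TransE E m) (a : {x // E x m}) :
    TransE (SE E m) a ↔ TransE E a.1 :=
  ⟨fun h y hy z hz => h ⟨y, hm _ a.2 y hy⟩ hy ⟨z, hm _ (hm _ a.2 y hy) z hz⟩ hz,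
    fun h y hy z hz => h y.1 hy z.1 hz⟩

theorem abs_pow (hm : TransE E m) (hs : ∀ x, E x m → ∀ y, SubE E y x → E y m)
    (p a : {x // E x m}) : PowSpecE (SE E m) p a ↔ PowSpecE E p.1 a.1 := by
  simp only [PowSpecE, abs_sub hm, Subtype.forall]
  exact forall_congr' fun z => ⟨fun h => ⟨fun hz => (h (hm _ p.2 z hz)).1 hz,
    fun hz => (h (hs _ a.2 z hz)).2 hz⟩, fun h _ => h⟩

theorem abs_union (hm : TransE E m) (u a : {x // E x m}) :
    (∀ z, SE E m z u ↔ ∃ y, SE E m y a ∧ SE E m z y) ↔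
      ∀ z, E z u.1 ↔ ∃ y, E y a.1 ∧ E z y := by
  have key : ∀ z : {x // E x m}, (∃ y, SE E m y a ∧ SE E m z y) ↔ ∃ y, E y a.1 ∧ E z.1 y :=
    fun z => ⟨fun ⟨y, h1, h2⟩ => ⟨y.1, h1, h2⟩, fun ⟨y, h1, h2⟩ => ⟨⟨y, hm _ a.2 y h1⟩, h1, h2⟩⟩
  simp only [key]
  constructor
  · intro h z
    constructor
    · intro hz
      exact (h ⟨z, hm _ u.2 z hz⟩).1 hz
    · rintro ⟨y, h1, h2⟩
      exact (h ⟨z, hm _ (hm _ a.2 y h1) z h2⟩).2 ⟨y, h1, h2⟩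
  · intro h z
    exact h z.1

end Abs

theorem good_opair {M : Type} {E : M → M → Prop} [hZ : ZFC E] {φ : SetFormula 0} {m : M}
    (hg : Good E φ m) {p x y : M} (hp : OPairE E p x y) (hx : E x m) (hy : E y m) : E p m := by
  obtain ⟨-, -, hpair, -⟩ := hg
  obtain ⟨s, hs, hs'⟩ := hpair x x hx hx
  obtain ⟨t, ht, ht'⟩ := hpair x y hx hy
  obtain ⟨q, hq, hq'⟩ := hpair s t hs ht
  rw [opair_uniq hp ⟨s, t, hs', ht', hq'⟩]
  exact hq

theorem good_model {M : Type} {E : M → M → Prop} [hZ : ZFC E] {φ : SetFormula 0} {m : M}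
    (hg : Good E φ m) : IsZFCE (SE E m) ∧ Realize (SE E m) φ ![] := by
  have hg' := hg
  obtain ⟨hm, hsup, hpair, hun, hpow, ⟨I, hIm, ⟨e, heI, he⟩, hI⟩, hrep, hφ⟩ := hg
  refine ⟨⟨⟨⟨I, hIm⟩⟩, ⟨?_, ?_, ?_, ?_, ?_, ?_, ?_⟩, ?_, ?_⟩, ?_⟩
  · intro x y h
    refine Subtype.ext (zext (E := E) fun z => ⟨fun hz => ?_, fun hz => ?_⟩)
    · exact (h ⟨z, hm _ x.2 z hz⟩).1 hz
    · exact (h ⟨z, hm _ y.2 z hz⟩).2 hz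
  · intro a b
    obtain ⟨p, hp, hp'⟩ := hpair a.1 b.1 a.2 b.2
    exact ⟨⟨p, hp⟩, (abs_upair hm _ _ _).2 hp'⟩
  · intro a
    obtain ⟨u, hu, hu'⟩ := hun a.1 a.2
    exact ⟨⟨u, hu⟩, (abs_union hm ⟨u, hu⟩ a).2 hu'⟩
  · refine ⟨⟨I, hIm⟩, ⟨⟨e, hm _ hIm e heI⟩, heI, (abs_empty hm _).2 he⟩, fun y hy => ?_⟩
    obtain ⟨s, hs, hs'⟩ := hI y.1 hy
    exact ⟨⟨s, hm _ hIm s hs⟩, hs, (abs_succ hm _ _).2 hs'⟩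
  · rintro a ⟨z, hz⟩
    obtain ⟨w, hw, hw'⟩ := zfound (E := E) a.1 ⟨z.1, hz⟩
    exact ⟨⟨w, hm _ a.2 w hw⟩, hw, fun z hz => hw' z.1 hz⟩
  · intro k ψ p a
    have hd : DefP E (fun s => RelR E (fun x => E x m) ψ (Fin.cons (s 0) (fun i => (p i).1))) := by
      refine defP_congr (defP_relR ψ (fun _ => m)
        (Fin.cons (fun s => s 0) (fun i _ => (p i).1)) (fun i => ?_)) fun s => ?_
      · refine Fin.cases ?_ (fun j => ?_) i <;> simp <;> infer_instance
      · refine iff_of_eq (congrArg _ ?_)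
        funext i
        refine Fin.cases ?_ (fun j => ?_) i <;> simp
    obtain ⟨s, hs⟩ := zsep (E := E)
      (fun z => RelR E (fun x => E x m) ψ (Fin.cons z (fun i => (p i).1))) a.1
    refine ⟨⟨s, hsup _ a.2 s fun z hz => ((hs z).1 hz).1⟩, fun z => ?_⟩
    refine (hs z.1).trans (and_congr Iff.rfl ?_)
    refine Iff.trans (iff_of_eq (congrArg _ ?_)) (relR_iff (E := E) ψ (Fin.cons z p))
    funext i
    refine Fin.cases ?_ (fun j => ?_) i <;> simp
  · intro k ψ p a hfun
    have hd : DefP E (fun s => RelR E (fun x => E x m) ψ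
        (Fin.cons (s 0) (Fin.cons (s 1) (fun i => (p i).1)))) := by
      refine defP_congr (defP_relR ψ (fun _ => m)
        (Fin.cons (fun s => s 0) (Fin.cons (fun s => s 1) (fun i _ => (p i).1)))
        (fun i => ?_)) fun s => ?_
      · refine Fin.cases ?_ (fun j => Fin.cases ?_ (fun j => ?_) j) i <;> simp <;> infer_instance
      · refine iff_of_eq (congrArg _ ?_)
        funext i
        refine Fin.cases ?_ (fun j => Fin.cases ?_ (fun j => ?_) j) i <;> simp
    have key : ∀ x y : {x // E x m},
        RelR E (fun x => E x m) ψ (Fin.cons x.1 (Fin.cons y.1 (fun i => (p i).1))) ↔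
        Realize (SE E m) ψ (Fin.cons x (Fin.cons y p)) := by
      intro x y
      refine Iff.trans (iff_of_eq (congrArg _ ?_))
        (relR_iff (E := E) ψ (Fin.cons x (Fin.cons y p)))
      funext i
      refine Fin.cases ?_ (fun j => Fin.cases ?_ (fun j => ?_) j) i <;> simp
    set R : M → M → Prop := fun x y => E y m ∧ RelR E (fun x => E x m) ψ
        (Fin.cons x (Fin.cons y (fun i => (p i).1))) with hR
    have hdR : DefP E (fun s => R (s 0) (s 1)) := by
      simp only [hR]; infer_instance
    have hRf : ∀ x, E x a.1 → ∀ y y', R x y → R x y' → y = y' := by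
      rintro x hx y y' ⟨h1, h2⟩ ⟨h3, h4⟩
      have hxm := hm _ a.2 x hx
      have := hfun ⟨x, hxm⟩ hx ⟨y, h1⟩ ⟨y', h3⟩ ((key _ _).1 h2) ((key _ _).1 h4)
      exact congrArg Subtype.val this
    obtain ⟨b, hb⟩ := zrepl (E := E) R a.1 hRf
    obtain ⟨f, hf, hf'⟩ := mkrel (E := E) R a.1 hRf
    have hbm : E b m := by
      refine hrep a.1 f b a.2 (fun q hq => ?_) (fun y hy => ?_) ?_ (fun y hy => ?_)
      · obtain ⟨x, y, ⟨hx, hxy⟩, hp⟩ := (hf q).1 hq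
        exact good_opair hg' hp (hm _ a.2 x hx) hxy.1
      · obtain ⟨x, hx, hxy⟩ := (hb y).1 hy
        exact hxy.1
      · intro x y y' h1 h2
        exact hRf x ((hf' _ _).1 h1).1 y y' ((hf' _ _).1 h1).2 ((hf' _ _).1 h2).2
      · obtain ⟨x, hx, hxy⟩ := (hb y).1 hy
        exact ⟨x, hx, (hf' _ _).2 ⟨hx, hxy⟩⟩
    refine ⟨⟨b, hbm⟩, fun y => (hb y.1).trans ?_⟩
    constructor
    · rintro ⟨x, hx, hxy⟩
      exact ⟨⟨x, hm _ a.2 x hx⟩, hx, (key _ _).1 hxy.2⟩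
    · rintro ⟨x, hx, hxy⟩
      exact ⟨x.1, hx, y.2, (key _ _).2 hxy⟩
  · intro a
    obtain ⟨p, hp, hp'⟩ := hpow a.1 a.2
    exact ⟨⟨p, hp⟩, (abs_pow hm hsup _ _).2 hp'⟩
  · intro a h1 h2
    obtain ⟨c, hc⟩ := hZ.out.2.2.2 a.1 (fun x hx => by
      obtain ⟨z, hz⟩ := h1 ⟨x, hm _ a.2 x hx⟩ hx
      exact ⟨z.1, hz⟩) (fun x y hx hy hxy => by
      rintro ⟨z, hz, hz'⟩
      have hxm := hm _ a.2 x hx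
      refine h2 ⟨x, hxm⟩ ⟨y, hm _ a.2 y hy⟩ hx hy (fun h => hxy (congrArg Subtype.val h))
        ⟨⟨z, hm _ hxm z hz⟩, hz, hz'⟩)
    obtain ⟨u, hu, hu'⟩ := hun a.1 a.2
    obtain ⟨c', hc'⟩ := zsep (E := E) (fun z => E z c) u
    refine ⟨⟨c', hsup u hu c' fun z hz => ((hc' z).1 hz).1⟩, fun x hx => ?_⟩
    obtain ⟨z, hz1, hz2, hz3⟩ := hc x.1 hx
    refine ⟨⟨z, hm _ x.2 z hz2⟩, (hc' z).2 ⟨(hu' z).2 ⟨x.1, hx, hz2⟩, hz1⟩, hz2, fun z' h h' => ?_⟩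
    exact Subtype.ext (hz3 z'.1 ((hc' _).1 h).2 h')
  · have := (relR_iff (E := E) (S := fun x => E x m) φ ![])
    refine this.1 ?_
    convert hφ

theorem good_down {M : Type} {E : M → M → Prop} {φ : SetFormula 0} {m : M}
    (hg : Good E φ m) (m' : {x // E x m}) (hg' : Good (SE E m) φ m') : Good E φ m'.1 := by
  obtain ⟨hm, hsup, -⟩ := hg
  obtain ⟨km, ksup, kpair, kun, kpow, ⟨I, hIm, ⟨e, heI, he⟩, hI⟩, krep, kφ⟩ := hg'
  have up : ∀ x, E x m'.1 → E x m := fun x hx => hm _ m'.2 x hx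
  refine ⟨(abs_trans hm _).1 km, ?_, ?_, ?_, ?_, ?_, ?_, ?_⟩
  · intro x hx y hy
    exact ksup ⟨x, up x hx⟩ hx ⟨y, hsup x (up x hx) y hy⟩ ((abs_sub hm _ _).2 hy)
  · intro a b ha hb
    obtain ⟨p, hp, hp'⟩ := kpair ⟨a, up a ha⟩ ⟨b, up b hb⟩ ha hb
    exact ⟨p.1, hp, (abs_upair hm _ _ _).1 hp'⟩
  · intro a ha
    obtain ⟨p, hp, hp'⟩ := kun ⟨a, up a ha⟩ ha
    exact ⟨p.1, hp, (abs_union hm _ _).1 hp'⟩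
  · intro a ha
    obtain ⟨p, hp, hp'⟩ := kpow ⟨a, up a ha⟩ ha
    exact ⟨p.1, hp, (abs_pow hm hsup _ _).1 hp'⟩
  · refine ⟨I.1, hIm, ⟨e.1, heI, (abs_empty hm _).1 he⟩, fun y hy => ?_⟩
    obtain ⟨s, hs, hs'⟩ := hI ⟨y, hm _ I.2 y hy⟩ hy
    exact ⟨s.1, hs, (abs_succ hm _ _).1 hs'⟩
  · intro a f b ha hf hb hfun hcov
    have hfm : E f m := hsup _ m'.2 f hf
    have hbm : E b m := hsup _ m'.2 b hb
    refine krep ⟨a, up a ha⟩ ⟨f, hfm⟩ ⟨b, hbm⟩ ha ((abs_sub hm _ _).2 hf) ((abs_sub hm _ _).2 hb)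
      (fun x y y' h1 h2 => Subtype.ext
        (hfun _ _ _ ((abs_pairmem hm _ _ _).1 h1) ((abs_pairmem hm _ _ _).1 h2)))
      (fun y hy => ?_)
    obtain ⟨x, hx, hxy⟩ := hcov y.1 hy
    exact ⟨⟨x, hm _ (up a ha) x hx⟩, hx, (abs_pairmem hm _ _ _).2 hxy⟩
  · have := (relR_sub hm m' φ ![]).1 kφ
    convert this


/-! ## Reflection -/

section Refl
variable {M : Type} {E : M → M → Prop}

theorem defP_allv : ∀ (n : ℕ) (P : (ℕ → M) → (Fin n → M) → Prop)
    (_ : DefP E (fun s => P (fun i => s (i + n)) (fun i => s i))),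
    DefP E (fun s => ∀ v, P s v)
  | 0, P, h => by
      refine defP_congr h fun s => ?_
      constructor
      · intro h; exact h _
      · intro h v
        have : v = fun i : Fin 0 => s i := funext fun i => i.elim0
        rw [this]; exact h
  | n + 1, P, h => by
      have h1 : DefP E (fun s => ∀ a, ∀ v : Fin n → M,
          P s (Fin.snoc (α := fun _ : Fin (n + 1) => M) v a)) := by
        refine @defP_all M E _ ?_
        refine defP_allv n (fun s v => P (fun i => s (i + 1))
          (Fin.snoc (α := fun _ : Fin (n + 1) => M) v (s 0))) ?_
        refine defP_congr h fun s => ?_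
        have e1 : (fun i => s (i + 1 + n)) = (fun i => s (i + (n + 1))) := by
          funext i; congr 1; omega
        have e2 : (Fin.snoc (α := fun _ : Fin (n + 1) => M) (fun i : Fin n => s i) (s (0 + n)))
            = fun i : Fin (n + 1) => s i := by
          funext i
          refine Fin.lastCases ?_ (fun j => ?_) i <;> simp
        rw [e1, e2]
      refine defP_congr h1 fun s => ?_
      constructor
      · intro h a v; exact h _
      · intro h v
        have := h (v (Fin.last n)) (fun i => v i.castSucc)
        rwa [show (Fin.snoc (α := fun _ : Fin (n + 1) => M) (fun i => v i.castSucc)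
          (v (Fin.last n))) = v from Fin.snoc_init_self v] at this

theorem defP_fin : ∀ (n : ℕ) (P : Fin n → (ℕ → M) → Prop) (_ : ∀ i, DefP E (P i)),
    DefP E (fun s => ∀ i, P i s)
  | 0, P, h => defP_congr (P := fun _ => True) inferInstance
      fun s => ⟨fun _ => trivial, fun _ i => i.elim0⟩
  | n + 1, P, h => by
      have h1 := defP_fin n (fun i => P i.succ) (fun i => h i.succ)
      have h0 := h 0
      refine defP_congr (@defP_and M E _ _ h0 h1) fun s => ?_
      exact Fin.forall_fin_succ

theorem defP_realize {n : ℕ} (φ : SetFormula n) (u : Fin n → (ℕ → M) → M)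
    (hu : ∀ i, DefT (u i)) : DefP E (fun s => Realize E φ (fun i => u i s)) := by
  choose c hc using fun i => (hu i).out
  exact ⟨n, φ, c, fun s => by simp only [hc]⟩

/-- Definable total relations on the ordinals, upwards closed in the second coordinate. -/
structure UpR (E : M → M → Prop) (R : M → M → Prop) : Prop where
  dfn : Def2 E R
  up : ∀ b g g', OrdE E g' → E g g' → R b g → R b g'
  tot : ∀ b, OrdE E b → ∃ g, OrdE E g ∧ R b g

/-- `a` is closed under `R`. -/
def Clo (E : M → M → Prop) (R : M → M → Prop) (a : M) : Prop := ∀ b, E b a → ∃ g, E g a ∧ R b g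

variable [hZ : ZFC E]

theorem UpR.and {R S : M → M → Prop} (hR : UpR E R) (hS : UpR E S) :
    UpR E (fun b g => R b g ∧ S b g) := by
  have := hR.dfn
  have := hS.dfn
  refine ⟨⟨inferInstance⟩, fun b g g' h1 h2 h3 => ⟨hR.up b g g' h1 h2 h3.1, hS.up b g g' h1 h2 h3.2⟩,
    fun b hb => ?_⟩
  obtain ⟨g, hg, h⟩ := hR.tot b hb
  obtain ⟨g', hg', h'⟩ := hS.tot b hb
  rcases ord_tri hg hg' with h1 | rfl | h1
  · exact ⟨g', hg', hR.up b g g' hg' h1 h, h'⟩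
  · exact ⟨g, hg, h, h'⟩
  · exact ⟨g, hg, h, hS.up b g' g hg h1 h'⟩

theorem tuple_collect {V : M → M → Prop} (hV : IsHier E V) {b : M} (hb : OrdE E b) :
    ∀ (n : ℕ) (Q : (Fin n → M) → M → Prop) (_ : DefP E (fun s => Q (fun i => s (i + 1)) (s 0)))
    (_ : ∀ v g g', OrdE E g' → E g g' → Q v g → Q v g') (_ : ∀ v, ∃ g, OrdE E g ∧ Q v g),
    ∃ g, OrdE E g ∧ ∀ v, (∀ i, V (v i) b) → Q v g
  | 0, Q, hd, hup, ht => by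
      obtain ⟨g, hg, h⟩ := ht ![]
      refine ⟨g, hg, fun v _ => ?_⟩
      rwa [show v = ![] from funext fun i => i.elim0]
  | n + 1, Q, hd, hup, ht => by
      have := hV.dfn
      obtain ⟨g, hg, h⟩ := tuple_collect hV hb n
        (fun v g => ∀ x, V x b → Q (Fin.cons (α := fun _ : Fin (n + 1) => M) x v) g) (by
          refine @defP_all M E _ ?_
          refine @defP_imp M E _ _ inferInstance ?_
          have := defP_subst hd (fun k s => if k = 0 then s 1 else if k = 1 then s 0 else s k)
            (fun i => by split_ifs <;> infer_instance)
          refine defP_congr this fun s => ?_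
          have e : (Fin.cons (α := fun _ : Fin (n + 1) => M) (s 0) fun i : Fin n => s (i + 1 + 1))
            = fun i : Fin (n + 1) => if (i : ℕ) + 1 = 0 then s 1 else if (i : ℕ) + 1 = 1 then s 0
              else s (i + 1) := by
            funext i
            refine Fin.cases ?_ (fun j => ?_) i <;> simp
          simp only [e]; simp)
        (fun v g g' h1 h2 h3 x hx => hup _ g g' h1 h2 (h3 x hx))
        (fun v => by
          obtain ⟨vb, hvb⟩ := hV.set b hb
          have hdd : DefP E (fun s => Q (Fin.cons (α := fun _ : Fin (n + 1) => M) (s 0) v) (s 1)) := by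
            have := defP_subst hd (fun k s => if k = 0 then s 1 else if k = 1 then s 0 else
              if h : k - 2 < n then v ⟨k - 2, h⟩ else s 0)
              (fun i => by split_ifs <;> infer_instance)
            refine defP_congr this fun s => ?_
            simp only [if_true]
            refine iff_of_eq (congrArg (fun w => Q w (s 1)) ?_)
            funext i
            refine Fin.cases ?_ (fun j => ?_) i <;> simp
          obtain ⟨g, hg, h⟩ := ord_collect (E := E)
            (fun x g => Q (Fin.cons (α := fun _ : Fin (n + 1) => M) x v) g) vb
            (fun x _ => ht _)
          refine ⟨g, hg, fun x hx => ?_⟩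
          obtain ⟨c, hc, h⟩ := h x ((hvb x).2 hx)
          exact hup _ c g hg hc h)
      refine ⟨g, hg, fun v hv => ?_⟩
      have := h (fun i => v i.succ) (fun i => hv _) (v 0) (hv 0)
      rwa [show (Fin.cons (α := fun _ : Fin (n + 1) => M) (v 0) fun i => v i.succ) = v from
        Fin.cons_self_tail v] at this

theorem hier_below {V : M → M → Prop} (hV : IsHier E V) {a x : M} (ha : LimitE E a) (hx : V x a) :
    ∃ b, E b a ∧ V x b := by
  obtain ⟨c, hc, h⟩ := (hV.spec a ha.1 x).1 hx
  obtain ⟨b, hb, hcb⟩ := ha.2.2 c hc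
  exact ⟨b, hb, (hV.spec b (ord_mem ha.1 hb) x).2 ⟨c, hcb, h⟩⟩

theorem hier_tuple {V : M → M → Prop} (hV : IsHier E V) {a : M} (ha : LimitE E a) :
    ∀ (n : ℕ) (v : Fin n → M), (∀ i, V (v i) a) → ∃ b, E b a ∧ ∀ i, V (v i) b
  | 0, v, h => by
      obtain ⟨w, hw⟩ := ha.2.1
      exact ⟨w, hw, fun i => i.elim0⟩
  | n + 1, v, h => by
      obtain ⟨b, hb, hb'⟩ := hier_tuple hV ha n (fun i => v i.succ) (fun i => h _)
      obtain ⟨c, hc, hc'⟩ := hier_below hV ha (h 0)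
      have ob := ord_mem ha.1 hb
      have oc := ord_mem ha.1 hc
      rcases ord_tri ob oc with h1 | rfl | h1
      · exact ⟨c, hc, fun i => Fin.cases hc' (fun j => hier_mono hV oc h1 (hb' j)) i⟩
      · exact ⟨b, hb, fun i => Fin.cases hc' (fun j => hb' j) i⟩
      · exact ⟨b, hb, fun i => Fin.cases (hier_mono hV ob h1 hc') (fun j => hb' j) i⟩

theorem upR_true : UpR E (fun _ _ => True) :=
  ⟨⟨inferInstance⟩, fun _ _ _ _ _ h => h, fun b hb => ⟨b, hb, trivial⟩⟩

theorem reflect {V : M → M → Prop} (hV : IsHier E V) : ∀ {n : ℕ} (φ : SetFormula n),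
    ∃ R, UpR E R ∧ ∀ a, LimitE E a → Clo E R a → ∀ v : Fin n → M, (∀ i, V (v i) a) →
      (RelR E (fun x => V x a) φ v ↔ Realize E φ v)
  | _, .mem i j => ⟨_, upR_true, fun _ _ _ _ _ => Iff.rfl⟩
  | _, .eq i j => ⟨_, upR_true, fun _ _ _ _ _ => Iff.rfl⟩
  | _, .fal => ⟨_, upR_true, fun _ _ _ _ _ => Iff.rfl⟩
  | _, .imp φ ψ => by
      obtain ⟨R, hR, h⟩ := reflect hV φ
      obtain ⟨S, hS, k⟩ := reflect hV ψ
      refine ⟨_, hR.and hS, fun a ha hc v hv => ?_⟩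
      have h1 := h a ha (fun b hb => let ⟨g, hg, h⟩ := hc b hb; ⟨g, hg, h.1⟩) v hv
      have h2 := k a ha (fun b hb => let ⟨g, hg, h⟩ := hc b hb; ⟨g, hg, h.2⟩) v hv
      simp only [RelR, Realize, h1, h2]
  | n, .all φ => by
      have := hV.dfn
      obtain ⟨R, hR, h⟩ := reflect hV φ
      have hreal : DefP E (fun s => Realize E φ (Fin.snoc (α := fun _ : Fin (n + 1) => M)
          (fun i => s (i + 1)) (s 0))) := by
        refine defP_congr (defP_realize φ (Fin.snoc (α := fun _ : Fin (n + 1) => (ℕ → M) → M)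
          (fun i s => s (i + 1)) (fun s => s 0)) fun i => ?_) fun s => ?_
        · refine Fin.lastCases ?_ (fun j => ?_) i <;> simp <;> infer_instance
        · refine iff_of_eq (congrArg _ ?_)
          funext i
          refine Fin.lastCases ?_ (fun j => ?_) i <;> simp
      let Q : (Fin n → M) → M → Prop := fun v g =>
        (∃ a, ¬ Realize E φ (Fin.snoc (α := fun _ : Fin (n + 1) => M) v a)) →
          ∃ a, V a g ∧ ¬ Realize E φ (Fin.snoc (α := fun _ : Fin (n + 1) => M) v a)
      have hQd : DefP E (fun s => Q (fun i => s (i + 1)) (s 0)) := by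
        have hr2 := defP_subst hreal (fun k s => if k = 0 then s 0 else s (k + 1))
          (fun i => by split_ifs <;> infer_instance)
        simp only [if_true, Nat.add_eq_zero_iff, one_ne_zero, and_false, if_false] at hr2
        refine @defP_imp M E _ _ ?_ ?_
        · refine @defP_ex M E _ ?_
          exact @defP_not M E _ hr2
        · refine @defP_ex M E _ ?_
          refine @defP_and M E _ _ inferInstance ?_
          exact @defP_not M E _ hr2
      have hQu : ∀ v g g', OrdE E g' → E g g' → Q v g → Q v g' := by
        intro v g g' h1 h2 h3 h4
        obtain ⟨a, ha, ha'⟩ := h3 h4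
        exact ⟨a, hier_mono hV h1 h2 ha, ha'⟩
      have hT : UpR E (fun b g => ∀ v : Fin n → M, (∀ i, V (v i) b) → Q v g) := by
        refine ⟨⟨?_⟩, fun b g g' h1 h2 h3 v hv => hQu v g g' h1 h2 (h3 v hv), fun b hb => ?_⟩
        · refine defP_allv n (fun s v => (∀ i, V (v i) (s 0)) → Q v (s 1)) ?_
          refine @defP_imp M E _ _ ?_ ?_
          · exact defP_fin n (fun i s => V (s i) (s (0 + n))) fun i => inferInstance
          · have := defP_subst hQd (fun k s => if k = 0 then s (1 + n) else s (k - 1))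
              (fun i => by split_ifs <;> infer_instance)
            refine defP_congr this fun s => ?_
            simp
        · refine tuple_collect hV hb n Q hQd hQu fun v => ?_
          by_cases hv : ∃ a, ¬ Realize E φ (Fin.snoc (α := fun _ : Fin (n + 1) => M) v a)
          · obtain ⟨a, ha⟩ := hv
            obtain ⟨g, hg, hg'⟩ := hier_rank hV a
            exact ⟨g, hg, fun _ => ⟨a, hg', ha⟩⟩
          · exact ⟨b, hb, fun h => absurd h hv⟩
      refine ⟨_, hR.and hT, fun a ha hc v hv => ?_⟩
      have h1 := h a ha (fun b hb => let ⟨g, hg, h⟩ := hc b hb; ⟨g, hg, h.1⟩)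
      have hsn : ∀ x, V x a → ∀ i, V (Fin.snoc (α := fun _ : Fin (n + 1) => M) v x i) a := by
        intro x hx i
        refine Fin.lastCases ?_ (fun j => ?_) i
        · simpa using hx
        · simpa using hv j
      simp only [RelR, Realize]
      constructor
      · intro h2 x
        by_contra hx
        obtain ⟨b, hb, hb'⟩ := hier_tuple hV ha n v hv
        obtain ⟨g, hg, -, hg'⟩ := hc b hb
        obtain ⟨y, hy, hy'⟩ := hg' v hb' ⟨x, hx⟩
        have hya := hier_mono hV ha.1 hg hy
        exact hy' ((h1 _ (hsn y hya)).1 (h2 y hya))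
      · intro h2 x hx
        exact (h1 _ (hsn x hx)).2 (h2 x)

end Refl


/-! ## Subtlety gives a good model -/

section Key
variable {M : Type} {E : M → M → Prop}

/-- The part of `A` above `d` admits a strictly increasing map into `δ`. -/
def WW (E : M → M → Prop) (δ d A : M) : Prop :=
  ∃ k, (∀ a, (E a A ∧ E d a) → ∃ ξ, E ξ δ ∧ PairMemE E k a ξ) ∧
    ∀ a a', (E a A ∧ E d a) → (E a' A ∧ E d a') → E a a' → ∀ ξ ξ', PairMemE E k a ξ →
      PairMemE E k a' ξ' → E ξ ξ'

instance defP_WW {t u w : (ℕ → M) → M} [DefT t] [DefT u] [DefT w] :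
    DefP E (fun s => WW E (t s) (u s) (w s)) :=
  sub3 (by unfold WW; infer_instance) t u w

theorem WW_congr {δ d A d' A' : M} (h : ∀ a, (E a A ∧ E d a) ↔ (E a A' ∧ E d' a)) :
    WW E δ d A ↔ WW E δ d' A' := by
  unfold WW
  simp only [h]

/-- `A` is unbounded in `α` and its minimum codes the minimal possible length. -/
def QQ (E : M → M → Prop) (α A : M) : Prop :=
  (∀ γ, E γ α → ∃ a, E a A ∧ E γ a) ∧
    ∃ d, E d A ∧ (∀ a, E a A → a = d ∨ E d a) ∧ WW E d d A ∧ ∀ δ, E δ d → ¬ WW E δ d A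

instance defP_QQ {t u : (ℕ → M) → M} [DefT t] [DefT u] :
    DefP E (fun s => QQ E (t s) (u s)) :=
  sub2 (by unfold QQ; infer_instance) t u

/-- Inductive sets. -/
def Indu (E : M → M → Prop) (I : M) : Prop :=
  (∃ e, E e I ∧ EmptyE E e) ∧ ∀ y, E y I → ∃ s, E s I ∧ SuccSpecE E s y

/-- `r` maps `δ` onto a superset of `x`. -/
def Cov (E : M → M → Prop) (δ r x : M) : Prop :=
  (∀ c z z', E c δ → PairMemE E r c z → PairMemE E r c z' → z = z') ∧
    ∀ z, E z x → ∃ c, E c δ ∧ PairMemE E r c z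

instance defP_Indu {t : (ℕ → M) → M} [DefT t] : DefP E (fun s => Indu E (t s)) :=
  sub1 (by unfold Indu; infer_instance) t
instance defP_Cov {t u w : (ℕ → M) → M} [DefT t] [DefT u] [DefT w] :
    DefP E (fun s => Cov E (t s) (u s) (w s)) :=
  sub3 (by unfold Cov; infer_instance) t u w

variable [hZ : ZFC E]

theorem upR_inf {V : M → M → Prop} (hV : IsHier E V) : UpR E (fun _ g => ∃ I, V I g ∧ Indu E I) := by
  have := hV.dfn
  refine ⟨⟨inferInstance⟩, ?_, fun b hb => ?_⟩
  · rintro b g g' h1 h2 ⟨I, hI, hI'⟩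
    exact ⟨I, hier_mono hV h1 h2 hI, hI'⟩
  · obtain ⟨I, hI⟩ := hZ.out.2.1.2.2.2.1
    obtain ⟨g, hg, h⟩ := hier_rank hV I
    exact ⟨g, hg, I, h, hI⟩

theorem upR_wo {V : M → M → Prop} (hV : IsHier E V) :
    UpR E (fun b g => ∀ x, V x b → ∃ δ, E δ g ∧ ∃ r, Cov E δ r x) := by
  have := hV.dfn
  refine ⟨⟨inferInstance⟩, ?_, fun b hb => ?_⟩
  · intro b g g' h1 h2 h x hx
    obtain ⟨δ, hδ, h⟩ := h x hx
    exact ⟨δ, h1.1 g h2 δ hδ, h⟩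
  · obtain ⟨vb, hvb⟩ := hV.set b hb
    obtain ⟨g, hg, h⟩ := ord_collect (E := E) (fun x δ => ∃ r, Cov E δ r x) vb (fun x _ => by
      obtain ⟨a, r, ha, h1, h2⟩ := zwo (E := E) x
      exact ⟨a, ha, r, h1, h2⟩)
    exact ⟨g, hg, fun x hx => h x ((hvb x).2 hx)⟩

/-- Coherence is impossible. -/
theorem no_coherence {α α' A B : M} (ha : OrdE E α) (ha' : OrdE E α') (hlt : E α' α)
    (hA : QQ E α A) (hAs : SubE E A α) (hB : QQ E α' B) (hBA : InterSpecE E B A α') : False := by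
  obtain ⟨hu, d, hdA, hdmin, ⟨k, hk1, hk2⟩, -⟩ := hA
  obtain ⟨-, d', hdB, hdmin', -, hno⟩ := hB
  have h1 := (hBA d').1 hdB
  have hda : E d α' := by
    rcases hdmin d' h1.1 with h | h
    · rw [← h]; exact h1.2
    · exact ha'.1 d' h1.2 d h
  have hdB' : E d B := (hBA d).2 ⟨hdA, hda⟩
  have hdd : d = d' := by
    rcases hdmin d' h1.1 with h | h
    · exact h.symm
    · rcases hdmin' d hdB' with h' | h'
      · exact h'
      · exact (zasymm h h').elim
  subst hdd
  obtain ⟨a0, ha0, hla⟩ := hu α' hlt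
  have oa0 : OrdE E a0 := ord_mem ha (hAs a0 ha0)
  obtain ⟨ξ0, hξ0, hp0⟩ := hk1 a0 ⟨ha0, oa0.1 α' hla d hda⟩
  refine hno ξ0 hξ0 ⟨k, ?_, ?_⟩
  · rintro a ⟨haB, hda'⟩
    have haA := (hBA a).1 haB
    obtain ⟨ξ, hξ, hp⟩ := hk1 a ⟨haA.1, hda'⟩
    exact ⟨ξ, hk2 a a0 ⟨haA.1, hda'⟩ ⟨ha0, oa0.1 α' hla d hda⟩ (oa0.1 α' hla a haA.2) ξ ξ0 hp hp0, hp⟩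
  · rintro a a' ⟨h1, h2⟩ ⟨h3, h4⟩
    exact hk2 a a' ⟨((hBA a).1 h1).1, h2⟩ ⟨((hBA a').1 h3).1, h4⟩

theorem qq_of_fail {V : M → M → Prop} (hV : IsHier E V) {α δ0 r x f b : M} (hα : LimitE E α)
    (hδ : E δ0 α) (hc : Cov E δ0 r x)
    (hf : ∀ x y y', PairMemE E f x y → PairMemE E f x y' → y = y')
    (hb : ∀ y, E y b → V y α) (hbx : ∀ y, E y b → ∃ u, E u x ∧ PairMemE E f u y)
    (hbn : ¬ V b α) : ∃ A, SubE E A α ∧ QQ E α A := by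
  have := hV.dfn
  have oδ := ord_mem hα.1 hδ
  obtain ⟨h, hh⟩ : ∃ h : M → M → Prop, h = fun ξ η => E ξ δ0 ∧ ∃ u y, PairMemE E r ξ u ∧
      PairMemE E f u y ∧ E y b ∧ OrdE E η ∧ V y η ∧ ∀ η', E η' η → ¬ V y η' := ⟨_, rfl⟩
  have hd : Def2 E h := ⟨by rw [hh]; infer_instance⟩
  have hfun : ∀ ξ η η', h ξ η → h ξ η' → η = η' := by
    rw [hh]
    rintro ξ η η' ⟨h1, u, y, h2, h3, h4, h5, h6, h7⟩ ⟨-, u', y', h2', h3', h4', h5', h6', h7'⟩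
    obtain rfl := hc.1 ξ u u' h1 h2 h2'
    obtain rfl := hf u y y' h3 h3'
    rcases ord_tri h5 h5' with k | k | k
    · exact absurd h6 (h7' _ k)
    · exact k
    · exact absurd h6' (h7 _ k)
  have hmem : ∀ ξ η, h ξ η → E ξ δ0 ∧ E η α := by
    rw [hh]
    rintro ξ η ⟨h1, u, y, h2, h3, h4, h5, h6, h7⟩
    refine ⟨h1, ?_⟩
    obtain ⟨c, hc, hc'⟩ := hier_below hV hα (hb y h4)
    rcases ord_tri h5 (ord_mem hα.1 hc) with k | k | k
    · exact hα.1.1 c hc η k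
    · rw [k]; exact hc
    · exact absurd hc' (h7 c k)
  have hunb : ∀ γ, E γ α → ∃ ξ η, h ξ η ∧ E γ η := by
    intro γ hγ
    by_contra hn
    apply hbn
    refine (hV.spec α hα.1 b).2 ⟨γ, hγ, fun y hy => ?_⟩
    obtain ⟨u, hu, huy⟩ := hbx y hy
    obtain ⟨ξ, hξ, hξu⟩ := hc.2 u hu
    obtain ⟨η, h1, h2, h3⟩ := ord_least (E := E) (fun η => V y η) hα.1 (hb y hy)
    have hhη : h ξ η := by
      rw [hh]
      exact ⟨hξ, u, y, hξu, huy, hy, h1, h2, h3⟩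
    have oγ := ord_mem hα.1 hγ
    rcases ord_tri h1 oγ with k | k | k
    · exact hier_mono hV oγ k h2
    · rw [← k]; exact h2
    · exact absurd ⟨ξ, η, hhη, k⟩ hn
  clear hh
  obtain ⟨rc, hrc⟩ : ∃ rc : M → M → Prop, rc = fun ξ η => h ξ η ∧
      ∀ ξ', E ξ' ξ → ∀ η', h ξ' η' → E η' η := ⟨_, rfl⟩
  have hrd : Def2 E rc := ⟨by rw [hrc]; infer_instance⟩
  have ordξ : ∀ ξ η, h ξ η → OrdE E ξ := fun ξ η k => ord_mem oδ (hmem ξ η k).1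
  have rinc : ∀ ξ ξ' η η', rc ξ η → rc ξ' η' → E η η' → E ξ ξ' := by
    rw [hrc]
    rintro ξ ξ' η η' ⟨h1, h2⟩ ⟨h3, h4⟩ hlt
    rcases ord_tri (ordξ _ _ h1) (ordξ _ _ h3) with k | k | k
    · exact k
    · subst k
      obtain rfl := hfun _ _ _ h1 h3
      exact absurd hlt (zirrefl _)
    · exact (zasymm hlt (h2 _ k _ h3)).elim
  have rfun : ∀ ξ ξ' η, rc ξ η → rc ξ' η → ξ = ξ' := by
    rw [hrc]
    rintro ξ ξ' η ⟨h1, h2⟩ ⟨h3, h4⟩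
    rcases ord_tri (ordξ _ _ h1) (ordξ _ _ h3) with k | k | k
    · exact absurd (h4 _ k _ h1) (zirrefl _)
    · exact k
    · exact absurd (h2 _ k _ h3) (zirrefl _)
  have runb : ∀ γ, E γ α → ∃ ξ η, rc ξ η ∧ E γ η := by
    intro γ hγ
    obtain ⟨ξ1, η1, h1, h2⟩ := hunb γ hγ
    obtain ⟨ξ, oξ, ⟨η, h3, h4⟩, hmin⟩ := ord_least (E := E) (fun ξ => ∃ η, h ξ η ∧ E γ η)
      (ordξ _ _ h1) ⟨η1, h1, h2⟩
    refine ⟨ξ, η, ?_, h4⟩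
    rw [hrc]
    refine ⟨h3, fun ξ' hξ' η' hη' => ?_⟩
    have oη := ord_mem hα.1 (hmem _ _ h3).2
    have oη' := ord_mem hα.1 (hmem _ _ hη').2
    rcases ord_tri (ord_mem hα.1 hγ) oη' with k | k | k
    · exact absurd ⟨η', hη', k⟩ (hmin ξ' hξ')
    · rw [← k]; exact h4
    · exact oη.1 γ h4 η' k
  have rmem : ∀ ξ η, rc ξ η → E ξ δ0 ∧ E η α := by
    rw [hrc]
    rintro ξ η ⟨h1, -⟩
    exact hmem _ _ h1
  clear hrc
  obtain ⟨X, hX⟩ := zsep (E := E) (fun η => E δ0 η ∧ ∃ ξ, rc ξ η) α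
  have hW : WW E δ0 δ0 X := by
    obtain ⟨k, -, hk⟩ := mkrel (E := E) (fun η ξ => rc ξ η) X
      (fun η _ ξ ξ' h1 h2 => rfun _ _ _ h1 h2)
    refine ⟨k, ?_, ?_⟩
    · rintro a ⟨h1, -⟩
      obtain ⟨-, -, ξ, hξ⟩ := (hX a).1 h1
      exact ⟨ξ, (rmem _ _ hξ).1, (hk _ _).2 ⟨h1, hξ⟩⟩
    · rintro a a' - - hlt ξ ξ' h1 h2
      exact rinc _ _ _ _ ((hk _ _).1 h1).2 ((hk _ _).1 h2).2 hlt
  obtain ⟨d, od, hdW, hdmin⟩ := ord_least (E := E) (fun δ => WW E δ δ0 X) oδ hW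
  have hdδ : d = δ0 ∨ E d δ0 := by
    rcases ord_tri od oδ with k | k | k
    · exact Or.inr k
    · exact Or.inl k
    · exact absurd hW (hdmin _ k)
  have hdα : E d α := by
    rcases hdδ with k | k
    · rw [k]; exact hδ
    · exact hα.1.1 _ hδ _ k
  have hdX : ∀ a, E a X → E d a := by
    intro a ha
    obtain ⟨h1, h2, -⟩ := (hX a).1 ha
    rcases hdδ with k | k
    · rw [k]; exact h2
    · exact (ord_mem hα.1 h1).1 _ h2 _ k
  obtain ⟨A, hA⟩ := zinsert (E := E) X d
  have hcg : ∀ δ, WW E δ d A ↔ WW E δ δ0 X := fun δ => WW_congr fun a => by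
    constructor
    · rintro ⟨h1, h2⟩
      rcases (hA a).1 h1 with k | k
      · exact ⟨k, ((hX a).1 k).2.1⟩
      · rw [k] at h2; exact absurd h2 (zirrefl _)
    · rintro ⟨h1, -⟩
      exact ⟨(hA a).2 (Or.inl h1), hdX a h1⟩
  refine ⟨A, ?_, ?_, d, (hA d).2 (Or.inr rfl), ?_, (hcg d).2 hdW, fun δ hδ hn => hdmin δ hδ ((hcg δ).1 hn)⟩
  · intro a ha
    rcases (hA a).1 ha with k | k
    · exact ((hX a).1 k).1
    · rw [k]; exact hdα
  · intro γ hγ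
    have key : ∃ μ, E μ α ∧ (γ = μ ∨ E γ μ) ∧ (δ0 = μ ∨ E δ0 μ) := by
      rcases ord_tri (ord_mem hα.1 hγ) oδ with k | k | k
      · exact ⟨δ0, hδ, Or.inr k, Or.inl rfl⟩
      · exact ⟨δ0, hδ, Or.inl k, Or.inl rfl⟩
      · exact ⟨γ, hγ, Or.inl rfl, Or.inr k⟩
    obtain ⟨μ, hμ, h1, h2⟩ := key
    obtain ⟨ξ, η, h3, h4⟩ := runb μ hμ
    have hηα := (rmem _ _ h3).2
    have oη := ord_mem hα.1 hηα
    have tr : ∀ z, (z = μ ∨ E z μ) → E z η := by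
      rintro z (k | k)
      · rw [k]; exact h4
      · exact oη.1 _ h4 _ k
    exact ⟨η, (hA η).2 (Or.inl ((hX η).2 ⟨hηα, tr _ h2, ξ, h3⟩)), tr _ h1⟩
  · intro a ha
    rcases (hA a).1 ha with k | k
    · exact Or.inr (hdX a k)
    · exact Or.inl k

theorem good_ex (φ : SetFormula 0) (hφ : Realize E φ ![]) (hsub : OrdSubtleDefE E) :
    ∃ m, Good E φ m := by
  by_contra hno
  obtain ⟨V, hV⟩ := hier_ex (E := E)
  have := hV.dfn
  obtain ⟨R0, hR0, hrefl⟩ := reflect hV φ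
  have hU := (hR0.and (upR_inf hV)).and (upR_wo hV)
  obtain ⟨R, hR⟩ : ∃ R : M → M → Prop, R = fun b g => ((R0 b g ∧ ∃ I, V I g ∧ Indu E I) ∧
    ∀ x, V x b → ∃ δ, E δ g ∧ ∃ r, Cov E δ r x) := ⟨_, rfl⟩
  rw [← hR] at hU
  have hRd := hU.dfn
  obtain ⟨C, hC⟩ : ∃ C : M → Prop, C = fun a => (OrdE E a ∧ (∃ w, E w a) ∧
    ∀ b, E b a → ∃ c, E c a ∧ E b c) ∧ ∀ b, E b a → ∃ g, E g a ∧ R b g := ⟨_, rfl⟩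
  have hCd : DefP E (fun s => C (s 0)) := by rw [hC]; infer_instance
  have hClim : ∀ a, C a → LimitE E a := by rw [hC]; exact fun a h => h.1
  have hCclo : ∀ a, C a → Clo E R a := by rw [hC]; exact fun a h => h.2
  have hclub : ClubClassE E C := by
    refine ⟨fun x hx => (hClim x hx).1, fun α hα => ?_, fun l hl hne hlim => ?_⟩
    · obtain ⟨a, ha, h1, h2, h3⟩ := club_unbounded (E := E) R hU.tot hα
      refine ⟨a, ?_, h1⟩
      rw [hC]
      exact ⟨⟨ha, ⟨α, h1⟩, h2⟩, h3⟩
    · rw [hC]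
      refine ⟨⟨hl, hne, fun b hb => ?_⟩, fun b hb => ?_⟩
      · obtain ⟨c, -, h1, h2⟩ := hlim b hb
        exact ⟨c, h2, h1⟩
      · obtain ⟨c, h0, h1, h2⟩ := hlim b hb
        obtain ⟨g, hg, hg'⟩ := hCclo c h0 b h1
        exact ⟨g, hl.1 c h2 g hg, hg'⟩
  have hQ : ∀ α, C α → ∃ A, SubE E A α ∧ QQ E α A := by
    intro α hα
    have hl := hClim α hα
    have hcl := hCclo α hα
    rw [hR] at hcl
    obtain ⟨v, hv⟩ := hV.set α hl.1
    by_contra hnQ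
    apply hno
    refine ⟨v, ?_, ?_, ?_, ?_, ?_, ?_, ?_, ?_⟩
    · intro y hy z hz
      exact (hv z).2 (hier_trans hV hl.1 ((hv y).1 hy) hz)
    · intro x hx y hy
      obtain ⟨c, hc, h⟩ := (hV.spec α hl.1 x).1 ((hv x).1 hx)
      exact (hv y).2 ((hV.spec α hl.1 y).2 ⟨c, hc, fun z hz => h z (hy z hz)⟩)
    · intro a b ha hb
      obtain ⟨p, hp⟩ := zpair (E := E) a b
      obtain ⟨c, hc, h⟩ := hier_tuple hV hl 2 ![a, b] (fun i => by
        fin_cases i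
        · exact (hv a).1 ha
        · exact (hv b).1 hb)
      refine ⟨p, (hv p).2 ((hV.spec α hl.1 p).2 ⟨c, hc, fun z hz => ?_⟩), hp⟩
      rcases (hp z).1 hz with rfl | rfl
      · exact h 0
      · exact h 1
    · intro a ha
      obtain ⟨u, hu⟩ := zunion (E := E) a
      obtain ⟨c, hc, h⟩ := hier_below hV hl ((hv a).1 ha)
      have oc := ord_mem hl.1 hc
      refine ⟨u, (hv u).2 ((hV.spec α hl.1 u).2 ⟨c, hc, fun z hz => ?_⟩), hu⟩
      obtain ⟨y, hy, hzy⟩ := (hu z).1 hz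
      exact hier_trans hV oc (hier_trans hV oc h hy) hzy
    · intro a ha
      obtain ⟨p, hp⟩ := zpow (E := E) a
      obtain ⟨c, hc, h⟩ := (hV.spec α hl.1 a).1 ((hv a).1 ha)
      obtain ⟨c', hc', hcc⟩ := hl.2.2 c hc
      refine ⟨p, (hv p).2 ((hV.spec α hl.1 p).2 ⟨c', hc', fun z hz => ?_⟩), hp⟩
      exact (hV.spec c' (ord_mem hl.1 hc') z).2 ⟨c, hcc, fun w hw => h w ((hp z).1 hz w hw)⟩
    · obtain ⟨w, hw⟩ := hl.2.1
      obtain ⟨g, hg, ⟨-, I, hI, hI'⟩, -⟩ := hcl w hw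
      exact ⟨I, (hv I).2 (hier_mono hV hl.1 hg hI), hI'⟩
    · intro a f b ha _ hb hfun hcov
      by_contra hbn
      apply hnQ
      obtain ⟨c, hc, hac⟩ := hier_below hV hl ((hv a).1 ha)
      obtain ⟨g, hg, -, hwo⟩ := hcl c hc
      obtain ⟨δ, hδ, r, hr⟩ := hwo a hac
      exact qq_of_fail hV hl (hl.1.1 g hg δ hδ) hr hfun (fun y hy => (hv y).1 (hb y hy)) hcov
        (fun h => hbn ((hv b).2 h))
    · have e : (fun x => E x v) = (fun x => V x α) := funext fun x => propext (hv x)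
      rw [e]
      refine (hrefl α hl (fun b hb => ?_) ![] (fun i => i.elim0)).2 hφ
      obtain ⟨g, hg, ⟨h, -⟩, -⟩ := hcl b hb
      exact ⟨g, hg, h⟩
  obtain ⟨F, hF⟩ : ∃ F : M → M → Prop, F = fun α A => SubE E A α ∧ (QQ E α A ∨
    ∀ B, ¬ (SubE E B α ∧ QQ E α B)) := ⟨_, rfl⟩
  have hFd : DefP E (fun s => F (s 0) (s 1)) := by rw [hF]; infer_instance
  obtain ⟨a⟩ := hZ.out.1
  obtain ⟨k, ψ, p, hψ⟩ := to2 hFd a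
  obtain ⟨k', χ, q, hχ⟩ := to1 hCd a
  have key := hsub k k' ψ p χ q
  simp only [SubtleForE, hψ] at key
  rw [show (fun x => Realize E χ (Fin.cons x q)) = C from funext fun x => propext (hχ x)] at key
  simp only [hχ] at key
  obtain ⟨α, β, A, B, h1, h2, h3, h4, h5, h6⟩ := key (fun α _ => by
    rw [hF]
    refine ⟨?_, fun A h => h.1⟩
    by_cases hex : ∃ B, SubE E B α ∧ QQ E α B
    · obtain ⟨B, hB⟩ := hex
      exact ⟨B, hB.1, Or.inl hB.2⟩
    · exact ⟨α, fun z hz => hz, Or.inr fun B hB => hex ⟨B, hB⟩⟩) hclub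
  have fin : ∀ α A, C α → F α A → SubE E A α ∧ QQ E α A := by
    rw [hF]
    rintro α A hc ⟨h, h' | h'⟩
    · exact ⟨h, h'⟩
    · obtain ⟨B, hB⟩ := hQ α hc
      exact absurd hB (h' B)
  have g1 := fin β A h2 h4
  have g2 := fin α B h1 h6
  exact no_coherence (hClim β h2).1 (hClim α h1).1 h3 g1.2 g1.1 g2.2 h5

end Key


theorem main_aux (φ : SetFormula 0)
    (hcon : ∃ (M : Type) (E : M → M → Prop), IsZFCE E ∧ Realize E φ ![])
    (hall : ∀ (M : Type) (E : M → M → Prop), IsZFCE E → Realize E φ ![] → OrdSubtleDefE E) :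
    False := by
  obtain ⟨M, E, hE, hφ⟩ := hcon
  have hZ : ZFC E := ⟨hE⟩
  obtain ⟨m0, h0⟩ := good_ex φ hφ (hall M E hE hφ)
  have hmin : ∃ m, Good E φ m ∧ ∀ m', E m' m → ¬ Good E φ m' := by
    by_cases hex : ∃ m, E m m0 ∧ Good E φ m
    · obtain ⟨m, hm, hg⟩ := hex
      have := defP_good (E := E) φ
      obtain ⟨s, hs⟩ := zsep (E := E) (fun x => Good E φ x) m0
      obtain ⟨m1, h1, h2⟩ := zfound (E := E) s ⟨m, (hs m).2 ⟨hm, hg⟩⟩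
      have h3 := (hs m1).1 h1
      exact ⟨m1, h3.2, fun m' hm' hg' => h2 m' ((hs m').2 ⟨h0.1 m1 h3.1 m' hm', hg'⟩) hm'⟩
    · exact ⟨m0, h0, fun m' hm' hg' => hex ⟨m', hm', hg'⟩⟩
  obtain ⟨m, hg, hmin⟩ := hmin
  obtain ⟨hN, hNφ⟩ := good_model hg
  have hZN : ZFC (SE E m) := ⟨hN⟩
  obtain ⟨m', hgd⟩ := good_ex φ hNφ (hall _ _ hN hNφ)
  exact hmin m'.1 m'.2 (good_down hg m' hgd)

/-- **Proposition 1.8.** If `φ` is a sentence in the first-order language of set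
theory such that `ZFC + φ` is consistent, then `ZFC + φ` does not prove the scheme
"`Ord` is essentially subtle".  (By the Gödel completeness theorem, consistency is
rendered as the existence of a model and provability as truth in all models.) -/
theorem not_proves_ordSubtle_of_consistent (φ : SetFormula 0)
    (hcon : ∃ (M : Type) (E : M → M → Prop), IsZFCE E ∧ Realize E φ ![]) :
    ¬ ∀ (M : Type) (E : M → M → Prop), IsZFCE E → Realize E φ ![] →
        OrdSubtleDefE E := by
  exact fun hall => main_aux φ hcon hall

end Paper
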